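/- arXiv:1503.03733 — 13 statements merged into one kernel-verified Lean document; each statement's English description precedes it below -/
import Mathlib

section
/- Let S be a pseudogroup on a set X. Then S admits an invariant mean if and only if for no integer m ≥ 1 does there exist a Tarski matrix of degree m over S. -/
open Set

/-- A partial bijection, encoded as a functional and injective relation. -/
def IsPartialBij {α β : Type*} (r : Set (α × β)) : Prop :=
  (∀ ⦃x : α⦄ ⦃y y' : β⦄, (x, y) ∈ r → (x, y') ∈ r → y = y') ∧
  (∀ ⦃x x' : α⦄ ⦃y : β⦄, (x, y) ∈ r → (x', y) ∈ r → x = x')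

/-- The domain of a relation. -/
def pdom {α β : Type*} (r : Set (α × β)) : Set α := {x | ∃ y, (x, y) ∈ r}

/-- The range of a relation. -/
def pran {α β : Type*} (r : Set (α × β)) : Set β := {y | ∃ x, (x, y) ∈ r}

/-- The inverse of a relation. -/
def pinv {α β : Type*} (r : Set (α × β)) : Set (β × α) := {p | (p.2, p.1) ∈ r}

/-- The composite `r ∘ s`, defined on those `x ∈ pdom s` with `s x ∈ pdom r`. -/
def pcomp {X : Type*} (r s : Set (X × X)) : Set (X × X) :=
  {p | ∃ z, (p.1, z) ∈ s ∧ (z, p.2) ∈ r}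

/-- The identity map of the subset `A`. -/
def pid {X : Type*} (A : Set X) : Set (X × X) := {p | p.1 ∈ A ∧ p.2 = p.1}

/-- A pseudogroup on `X`: a set of partial bijections of `X` containing the identity of
every subset and closed under inverses, composition, and union of two members with
disjoint domains and disjoint ranges. -/
structure IsPseudogroup {X : Type*} (S : Set (Set (X × X))) : Prop where
  partialBij : ∀ r ∈ S, IsPartialBij r
  id_mem : ∀ A : Set X, pid A ∈ S
  inv_mem : ∀ r ∈ S, pinv r ∈ S
  comp_mem : ∀ r ∈ S, ∀ s ∈ S, pcomp r s ∈ S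
  union_mem : ∀ r ∈ S, ∀ s ∈ S,
    Disjoint (pdom r) (pdom s) → Disjoint (pran r) (pran s) → r ∪ s ∈ S

/-- An invariant mean on a pseudogroup `S` on `X`. -/
def IsInvariantMean {X : Type*} (S : Set (Set (X × X))) (μ : Set X → ℝ) : Prop :=
  (∀ A : Set X, 0 ≤ μ A) ∧ μ Set.univ = 1 ∧
  (∀ A B : Set X, Disjoint A B → μ (A ∪ B) = μ A + μ B) ∧
  (∀ r ∈ S, μ (pdom r) = μ (pran r))

/-- A Tarski matrix of degree `m` over `S`: an `m × (m+1)` matrix of elements of `S` such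
that each column's domains are pairwise disjoint with union `X`, and each row's ranges are
pairwise disjoint. -/
def IsTarskiMatrix {X : Type*} (S : Set (Set (X × X))) (m : ℕ)
    (f : Fin m → Fin (m + 1) → Set (X × X)) : Prop :=
  (∀ i j, f i j ∈ S) ∧
  (∀ (j : Fin (m + 1)) (i i' : Fin m), i ≠ i' →
    Disjoint (pdom (f i j)) (pdom (f i' j))) ∧
  (∀ j : Fin (m + 1), (⋃ i, pdom (f i j)) = Set.univ) ∧
  (∀ (i : Fin m) (j j' : Fin (m + 1)), j ≠ j' →
    Disjoint (pran (f i j)) (pran (f i j')))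

/-- The indicator of the domain minus the indicator of the range. -/
noncomputable def tmW {X : Type*} (r : Set (X × X)) : X → ℝ :=
  fun x => (pdom r).indicator 1 x - (pran r).indicator 1 x

/-- The space of bounded real functions. -/
def tmB (X : Type*) : Submodule ℝ (X → ℝ) where
  carrier := {f | ∃ C : ℝ, ∀ x, |f x| ≤ C}
  zero_mem' := ⟨0, by simp⟩
  add_mem' := by
    rintro f g ⟨C, hC⟩ ⟨D, hD⟩
    exact ⟨C + D, fun x => (abs_add_le _ _).trans (add_le_add (hC x) (hD x))⟩
  smul_mem' := by
    rintro c f ⟨C, hC⟩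
    refine ⟨|c| * C, fun x => ?_⟩
    simp only [Pi.smul_apply, smul_eq_mul, abs_mul]
    exact mul_le_mul_of_nonneg_left (hC x) (abs_nonneg _)

lemma tm_ind_mem {X : Type*} (A : Set X) : (A.indicator 1 : X → ℝ) ∈ tmB X := by
  refine ⟨1, fun x => ?_⟩
  by_cases h : x ∈ A <;> simp [h]

lemma tmW_abs {X : Type*} (r : Set (X × X)) (x : X) : |tmW r x| ≤ 1 := by
  unfold tmW
  by_cases h : x ∈ pdom r <;> by_cases h' : x ∈ pran r <;> simp [h, h']

lemma tm_approx {X : Type*} (S : Set (Set (X × X))) (w : X → ℝ)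
    (hw : w ∈ Submodule.span ℝ (tmW '' S)) :
    ∃ C : ℝ, ∀ t : ℝ, ∃ p ∈ AddSubgroup.closure (tmW '' S), ∀ x, |t * w x - p x| ≤ C := by
  induction hw using Submodule.span_induction with
  | mem w hw =>
    refine ⟨1, fun t => ⟨⌊t⌋ • w, AddSubgroup.zsmul_mem _ (AddSubgroup.subset_closure hw) _,
      fun x => ?_⟩⟩
    obtain ⟨r, hr, rfl⟩ := hw
    have h1 := tmW_abs r x
    have h2 : |t - ⌊t⌋| ≤ 1 := by
      rw [abs_le]; constructor <;> linarith [Int.floor_le t, Int.lt_floor_add_one t]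
    have : t * tmW r x - (⌊t⌋ • tmW r) x = (t - ⌊t⌋) * tmW r x := by
      simp only [Pi.smul_apply, zsmul_eq_mul]; ring
    rw [this, abs_mul]
    exact mul_le_one₀ h2 (abs_nonneg _) h1
  | zero => exact ⟨0, fun t => ⟨0, AddSubgroup.zero_mem _, by simp⟩⟩
  | add f g _ _ hf hg =>
    obtain ⟨C, hC⟩ := hf
    obtain ⟨D, hD⟩ := hg
    refine ⟨C + D, fun t => ?_⟩
    obtain ⟨p, hp, hp'⟩ := hC t
    obtain ⟨q, hq, hq'⟩ := hD t
    refine ⟨p + q, AddSubgroup.add_mem _ hp hq, fun x => ?_⟩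
    have : t * (f + g) x - (p + q) x = (t * f x - p x) + (t * g x - q x) := by
      simp only [Pi.add_apply]; ring
    rw [this]
    exact (abs_add_le _ _).trans (add_le_add (hp' x) (hq' x))
  | smul c f _ hf =>
    obtain ⟨C, hC⟩ := hf
    refine ⟨C, fun t => ?_⟩
    obtain ⟨p, hp, hp'⟩ := hC (t * c)
    refine ⟨p, hp, fun x => ?_⟩
    have := hp' x
    rwa [Pi.smul_apply, smul_eq_mul, ← mul_assoc]

lemma tmW_inv {X : Type*} (r : Set (X × X)) : tmW (pinv r) = - tmW r := by
  have h1 : pdom (pinv r) = pran r := rfl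
  have h2 : pran (pinv r) = pdom r := rfl
  funext x
  simp [tmW, h1, h2]

lemma tm_list {X : Type*} (S : Set (Set (X × X))) (hS : IsPseudogroup S) (p : X → ℝ)
    (hp : p ∈ AddSubgroup.closure (tmW '' S)) :
    ∃ l : List (Set (X × X)), (∀ r ∈ l, r ∈ S) ∧ p = (l.map tmW).sum := by
  induction hp using AddSubgroup.closure_induction with
  | mem w hw =>
    obtain ⟨r, hr, rfl⟩ := hw
    exact ⟨[r], by simpa using hr, by simp⟩
  | zero => exact ⟨[], by simp, by simp⟩
  | add f g _ _ hf hg =>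
    obtain ⟨l, hl, rfl⟩ := hf
    obtain ⟨l', hl', rfl⟩ := hg
    refine ⟨l ++ l', ?_, by simp⟩
    intro r hr
    rcases List.mem_append.1 hr with h | h
    exacts [hl _ h, hl' _ h]
  | neg f _ hf =>
    obtain ⟨l, hl, rfl⟩ := hf
    refine ⟨l.map pinv, ?_, ?_⟩
    · intro r hr
      obtain ⟨s, hs, rfl⟩ := List.mem_map.1 hr
      exact hS.inv_mem _ (hl _ hs)
    · rename_i hx
      clear hl hx
      induction l with
      | nil => simp
      | cons a l ih => rw [List.map_cons, List.sum_cons, neg_add, ih, List.map_cons, List.map_cons,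
          List.sum_cons, tmW_inv]

open Classical in
/-- Combinatorial part. -/
lemma tm_matrix {X : Type*} (S : Set (Set (X × X))) (hS : IsPseudogroup S) (n : ℕ)
    (g : Fin n → Set (X × X)) (hg : ∀ k, g k ∈ S)
    (h : ∀ x, (Finset.univ.filter (fun k => x ∈ pran (g k))).card + 1 ≤
      (Finset.univ.filter (fun k => x ∈ pdom (g k))).card) :
    ∃ f : Fin n → Fin (n + 1) → Set (X × X), IsTarskiMatrix S n f := by
  -- choice of the injections
  have hσ : ∀ x, ∃ σ : Option (Fin n) → Fin n,
      x ∈ pdom (g (σ none)) ∧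
      (∀ k, x ∈ pran (g k) → x ∈ pdom (g (σ (some k)))) ∧
      (∀ k, x ∈ pran (g k) → σ (some k) ≠ σ none) ∧
      (∀ k k', x ∈ pran (g k) → x ∈ pran (g k') → σ (some k) = σ (some k') → k = k') := by
    intro x
    set A := Finset.univ.filter (fun k => x ∈ pran (g k)) with hA
    set B := Finset.univ.filter (fun k => x ∈ pdom (g k)) with hB
    have hc : Fintype.card (Option A) ≤ Fintype.card B := by simpa using h x
    obtain ⟨e⟩ := Function.Embedding.nonempty_of_card_le hc
    have heB : ∀ o, x ∈ pdom (g (e o)) := fun o => (Finset.mem_filter.1 (e o).2).2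
    have hmA : ∀ k, x ∈ pran (g k) → k ∈ A := fun k hk => by simp [hA, hk]
    refine ⟨fun o => match o with
      | none => e none
      | some k => if hk : k ∈ A then e (some ⟨k, hk⟩) else e none, ?_, ?_, ?_, ?_⟩
    · exact heB _
    · intro k hk
      simp only [hmA k hk, dif_pos]
      exact heB _
    · intro k hk
      simp only [hmA k hk, dif_pos]
      intro heq
      have := e.injective (Subtype.ext heq)
      simp at this
    · intro k k' hk hk'
      simp only [hmA k hk, hmA k' hk', dif_pos]
      intro heq
      have := e.injective (Subtype.ext heq)
      simpa using this
  choose σ hσ0 hσ1 hσ2 hσ3 using hσ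
  have hE : (∅ : Set (X × X)) ∈ S := by
    have := hS.id_mem ∅
    convert this using 1
    ext p; simp [pid]
  -- the pieces
  let F : Fin n → Option (Fin n) → Set (X × X) := fun i o => match o with
    | none => pid {x | σ x none = i}
    | some k => pcomp (pid {y | σ y (some k) = i}) (g k) ∪
        pid {x | x ∉ pdom (g k) ∧ i = k}
  have mem_none : ∀ i x y, (x, y) ∈ F i none ↔ σ x none = i ∧ y = x := by
    intro i x y; rfl
  have mem_some : ∀ i k x y, (x, y) ∈ F i (some k) ↔
      ((x, y) ∈ g k ∧ σ y (some k) = i) ∨ (x ∉ pdom (g k) ∧ i = k ∧ y = x) := by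
    intro i k x y
    simp only [F, pcomp, pid, Set.mem_union, Set.mem_ofPred_eq]
    constructor
    · rintro (⟨z, h1, h2, h3⟩ | ⟨⟨h1, h2⟩, h3⟩)
      · subst h3; exact Or.inl ⟨h1, h2⟩
      · exact Or.inr ⟨h1, h2, h3⟩
    · rintro (⟨h1, h2⟩ | ⟨h1, h2, h3⟩)
      · exact Or.inl ⟨y, h1, h2, rfl⟩
      · exact Or.inr ⟨⟨h1, h2⟩, h3⟩
  have hpb := fun k => hS.partialBij _ (hg k)
  have key : ∃ f : Fin n → Option (Fin n) → Set (X × X), (∀ i j, f i j ∈ S) ∧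
      (∀ j i i', i ≠ i' → Disjoint (pdom (f i j)) (pdom (f i' j))) ∧
      (∀ j, (⋃ i, pdom (f i j)) = Set.univ) ∧
      (∀ i j j', j ≠ j' → Disjoint (pran (f i j)) (pran (f i j'))) := by
    refine ⟨F, ?_, ?_, ?_, ?_⟩
    · intro i j
      cases j with
      | none => exact hS.id_mem _
      | some k =>
        refine hS.union_mem _ (hS.comp_mem _ (hS.id_mem _) _ (hg k)) _ (hS.id_mem _) ?_ ?_
        · rw [Set.disjoint_left]
          rintro x ⟨y, z, h1, h2⟩ ⟨y', h3, h4⟩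
          exact h3.1 ⟨z, h1⟩
        · rw [Set.disjoint_left]
          rintro y ⟨x, z, h1, h2, h2'⟩ ⟨x', ⟨h3, h3'⟩, h4⟩
          simp only at h1 h2 h2' h3 h3' h4
          subst h2' h4 h3'
          apply h3
          have := hσ1 y i ⟨x, h1⟩
          rwa [h2] at this
    · intro j i i' hii
      rw [Set.disjoint_left]
      rintro x ⟨y, hy⟩ ⟨y', hy'⟩
      cases j with
      | none =>
        rw [mem_none] at hy hy'
        exact hii (hy.1.symm.trans hy'.1)
      | some k =>
        rw [mem_some] at hy hy'
        rcases hy with ⟨h1, h2⟩ | ⟨h1, h2, h3⟩ <;> rcases hy' with ⟨h1', h2'⟩ | ⟨h1', h2', h3'⟩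
        · have := (hpb k).1 h1 h1'
          subst this
          exact hii (h2.symm.trans h2')
        · exact h1' ⟨_, h1⟩
        · exact h1 ⟨_, h1'⟩
        · exact hii (h2.trans h2'.symm)
    · intro j
      rw [Set.eq_univ_iff_forall]
      intro x
      rw [Set.mem_iUnion]
      cases j with
      | none => exact ⟨σ x none, x, (mem_none _ _ _).2 ⟨rfl, rfl⟩⟩
      | some k =>
        by_cases hx : x ∈ pdom (g k)
        · obtain ⟨y, hy⟩ := hx
          exact ⟨σ y (some k), y, (mem_some _ _ _ _).2 (Or.inl ⟨hy, rfl⟩)⟩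
        · exact ⟨k, x, (mem_some _ _ _ _).2 (Or.inr ⟨hx, rfl, rfl⟩)⟩
    · have h0s : ∀ i k, Disjoint (pran (F i none)) (pran (F i (some k))) := by
        intro i k
        rw [Set.disjoint_left]
        rintro y ⟨x, hx⟩ ⟨x', hx'⟩
        rw [mem_none] at hx
        rw [mem_some] at hx'
        obtain ⟨h1, rfl⟩ := hx
        rcases hx' with ⟨h2, h3⟩ | ⟨h2, h3, h4⟩
        · exact hσ2 y k ⟨_, h2⟩ (h3.trans h1.symm)
        · subst h4 h3
          apply h2
          have := hσ0 y
          rwa [h1] at this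
      intro i j j' hjj
      cases j with
      | none =>
        cases j' with
        | none => exact absurd rfl hjj
        | some k => exact h0s i k
      | some k =>
        cases j' with
        | none => exact (h0s i k).symm
        | some k' =>
          rw [Set.disjoint_left]
          rintro y ⟨x, hx⟩ ⟨x', hx'⟩
          rw [mem_some] at hx hx'
          rcases hx with ⟨h1, h2⟩ | ⟨h1, h2, h3⟩ <;>
            rcases hx' with ⟨h1', h2'⟩ | ⟨h1', h2', h3'⟩
          · exact hjj (congrArg some (hσ3 y k k' ⟨_, h1⟩ ⟨_, h1'⟩ (h2.trans h2'.symm)))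
          · subst h3' h2'
            apply h1'
            have := hσ1 y k ⟨_, h1⟩
            rwa [h2] at this
          · subst h3 h2
            apply h1
            have := hσ1 y k' ⟨_, h1'⟩
            rwa [h2'] at this
          · exact hjj (congrArg some (h2.symm.trans h2'))
  obtain ⟨f, f1, f2, f3, f4⟩ := key
  let e := finSuccEquiv n
  exact ⟨fun i j => f i (e j), fun i j => f1 _ _, fun j => f2 _, fun j => f3 _,
    fun i j j' hjj => f4 i _ _ (fun hh => hjj (e.injective hh))⟩

open Classical in
lemma tm_list_matrix {X : Type*} (S : Set (Set (X × X))) (hS : IsPseudogroup S)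
    (l : List (Set (X × X))) (hl : ∀ r ∈ l, r ∈ S)
    (h : ∀ x, 1 ≤ (l.map tmW).sum x) :
    ∃ f : Fin l.length → Fin (l.length + 1) → Set (X × X), IsTarskiMatrix S l.length f := by
  refine tm_matrix S hS l.length (fun k => l[k]) (fun k => hl _ (List.getElem_mem _)) ?_
  intro x
  have h1 := h x
  have h2 : (l.map tmW).sum = ∑ k : Fin l.length, tmW l[k] := by
    rw [← List.sum_ofFn]
    congr 1
    apply List.ext_getElem <;> simp
  rw [h2, Finset.sum_apply] at h1
  simp only [tmW, Set.indicator_apply, Pi.one_apply, Finset.sum_sub_distrib,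
    Finset.sum_boole] at h1
  have h3 : ((Finset.univ.filter (fun k : Fin l.length => x ∈ pran l[k])).card : ℝ) + 1 ≤
      (Finset.univ.filter (fun k : Fin l.length => x ∈ pdom l[k])).card := by linarith
  exact_mod_cast h3

/-- The functional-analytic part. -/
lemma tm_mean {X : Type*} [Nonempty X] (S : Set (Set (X × X)))
    (h : ∀ w ∈ Submodule.span ℝ (tmW '' S), ∀ ε > 0, ¬ ∀ x, ε ≤ w x) :
    ∃ μ : Set X → ℝ, IsInvariantMean S μ := by
  let s : PointedCone ℝ (tmB X) :=
    { carrier := {v | ∃ w ∈ Submodule.span ℝ (tmW '' S), ∀ x, w x ≤ v.1 x}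
      smul_mem' := by
        rintro c v ⟨w, hw, hwv⟩
        exact ⟨(c : ℝ) • w, Submodule.smul_mem _ _ hw,
          fun x => mul_le_mul_of_nonneg_left (hwv x) c.2⟩
      zero_mem' := ⟨0, Submodule.zero_mem _, fun x => le_rfl⟩
      add_mem' := by
        rintro v v' ⟨w, hw, hwv⟩ ⟨w', hw', hwv'⟩
        exact ⟨w + w', Submodule.add_mem _ hw hw', fun x => add_le_add (hwv x) (hwv' x)⟩ }
  have hs : ∀ v : tmB X, v ∈ s ↔ ∃ w ∈ Submodule.span ℝ (tmW '' S), ∀ x, w x ≤ v.1 x :=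
    fun v => Iff.rfl
  let I : Set X → tmB X := fun A => ⟨A.indicator 1, tm_ind_mem A⟩
  have hI1 : ∀ x, (I Set.univ).1 x = 1 := fun x => by simp [I]
  have hne : I Set.univ ≠ 0 := by
    intro h0
    obtain ⟨x⟩ := ‹Nonempty X›
    have := hI1 x
    rw [h0] at this
    simp at this
  let f : (tmB X) →ₗ.[ℝ] ℝ := LinearPMap.mkSpanSingleton (I Set.univ) (1 : ℝ) hne
  have hfI : ∀ (c : ℝ) (hc : c • I Set.univ ∈ f.domain), f ⟨c • I Set.univ, hc⟩ = c := by
    intro c hc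
    have := LinearPMap.mkSpanSingleton'_apply (I Set.univ) (1 : ℝ)
      (fun c hc => by
        rcases smul_eq_zero.1 hc with h | h
        · simp [h]
        · exact absurd h hne) c hc
    exact this.trans (mul_one c)
  have hdom : ∀ v, v ∈ f.domain ↔ ∃ c : ℝ, c • I Set.univ = v :=
    fun v => Submodule.mem_span_singleton
  obtain ⟨G, hG1, hG2⟩ := riesz_extension s f (by
    rintro ⟨v, hv⟩ hvs
    obtain ⟨c, rfl⟩ := (hdom v).1 hv
    rw [hfI]
    obtain ⟨w, hw, hwv⟩ := (hs _).1 hvs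
    by_contra hc
    push Not at hc
    refine h (-w) (Submodule.neg_mem _ hw) (-c) (by linarith) fun x => ?_
    have := hwv x
    simp only [Submodule.coe_smul, Pi.smul_apply, hI1, smul_eq_mul, mul_one] at this
    simp only [Pi.neg_apply]
    linarith) (by
    rintro ⟨v, C, hC⟩
    refine ⟨⟨C • I Set.univ, (hdom _).2 ⟨C, rfl⟩⟩, ?_⟩
    refine ⟨0, Submodule.zero_mem _, fun x => ?_⟩
    have h1 := abs_le.1 (hC x)
    simp only [Submodule.coe_add, Submodule.coe_smul, Pi.add_apply, Pi.smul_apply, hI1,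
      smul_eq_mul, mul_one, Pi.zero_apply]
    linarith)
  refine ⟨fun A => G (I A), ?_, ?_, ?_, ?_⟩
  · intro A
    apply hG2
    refine ⟨0, Submodule.zero_mem _, fun x => ?_⟩
    exact Set.indicator_nonneg (fun _ _ => zero_le_one) x
  · have hm : (1 : ℝ) • I Set.univ ∈ f.domain := (hdom _).2 ⟨1, rfl⟩
    have h1 := hG1 ⟨_, hm⟩
    rw [hfI] at h1
    simpa using h1
  · intro A B hAB
    have : I (A ∪ B) = I A + I B := by
      apply Subtype.ext
      exact Set.indicator_union_of_disjoint hAB _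
    simp only [this, map_add]
  · intro r hr
    have hw : tmW r ∈ Submodule.span ℝ (tmW '' S) := Submodule.subset_span ⟨r, hr, rfl⟩
    have h1 : 0 ≤ G (I (pdom r) - I (pran r)) :=
      hG2 _ ⟨tmW r, hw, fun x => le_rfl⟩
    have h2 : 0 ≤ G (I (pran r) - I (pdom r)) := by
      refine hG2 _ ⟨-tmW r, Submodule.neg_mem _ hw, fun x => ?_⟩
      simp [tmW, I]
    rw [map_sub] at h1 h2
    show G _ = G _
    linarith

lemma tm_sum {X ι : Type*} (μ : Set X → ℝ) (h0 : μ ∅ = 0)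
    (ha : ∀ A B : Set X, Disjoint A B → μ (A ∪ B) = μ A + μ B) (s : Finset ι) (A : ι → Set X)
    (hA : ∀ i j, i ≠ j → Disjoint (A i) (A j)) :
    μ (⋃ i ∈ s, A i) = ∑ i ∈ s, μ (A i) := by
  classical
  induction s using Finset.induction_on with
  | empty => simpa using h0
  | insert a s has ih =>
    rw [Finset.set_biUnion_insert, ha, Finset.sum_insert has, ih]
    simp only [Set.disjoint_iUnion_right]
    intro i hi
    exact hA _ _ (fun h => has (h ▸ hi))

/-- A pseudogroup admits an invariant mean iff there is no Tarski matrix of any degree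
`m ≥ 1` over it. -/
theorem invariantMean_iff_no_tarskiMatrix {X : Type*} (S : Set (Set (X × X)))
    (hS : IsPseudogroup S) :
    (∃ μ : Set X → ℝ, IsInvariantMean S μ) ↔
    ¬ ∃ (m : ℕ) (_ : 1 ≤ m) (f : Fin m → Fin (m + 1) → Set (X × X)),
        IsTarskiMatrix S m f := by
  constructor
  · rintro ⟨μ, hpos, h1, hadd, hinv⟩ ⟨m, hm, f, hf, hd, hu, hr⟩
    have h0 : μ ∅ = 0 := by
      have := hadd ∅ ∅ (by simp)
      simp at this
      exact this
    have hle : ∀ A, μ A ≤ 1 := by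
      intro A
      have := hadd A Aᶜ disjoint_compl_right
      rw [Set.union_compl_self, h1] at this
      linarith [hpos Aᶜ]
    have e1 : ∀ j, ∑ i, μ (pdom (f i j)) = 1 := by
      intro j
      rw [← tm_sum μ h0 hadd Finset.univ (fun i => pdom (f i j)) (hd j)]
      simp [hu j, h1]
    have e2 : ∀ i, ∑ j, μ (pdom (f i j)) ≤ 1 := by
      intro i
      simp only [hinv _ (hf _ _)]
      rw [← tm_sum μ h0 hadd Finset.univ (fun j => pran (f i j)) (hr i)]
      exact hle _
    have e3 : ∑ j, ∑ i, μ (pdom (f i j)) = (m : ℝ) + 1 := by simp [e1]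
    have e4 : ∑ i, ∑ j, μ (pdom (f i j)) ≤ (m : ℝ) := by
      calc _ ≤ ∑ i : Fin m, (1 : ℝ) := Finset.sum_le_sum fun i _ => e2 i
        _ = m := by simp
    rw [Finset.sum_comm] at e3
    linarith
  · intro hno
    have hlist : ∀ l : List (Set (X × X)), 1 ≤ l.length → (∀ r ∈ l, r ∈ S) →
        ¬ ∀ x, 1 ≤ (l.map tmW).sum x := by
      intro l hn hl h
      obtain ⟨f, hf⟩ := tm_list_matrix S hS l hl h
      exact hno ⟨_, hn, f, hf⟩
    have hX : Nonempty X := by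
      by_contra hX
      rw [not_nonempty_iff] at hX
      exact hlist [pid ∅] (by simp) (by simpa using hS.id_mem ∅) (fun x => isEmptyElim x)
    apply tm_mean S
    intro w hw ε hε hwε
    obtain ⟨C, hC⟩ := tm_approx S w hw
    obtain ⟨p, hp, hpC⟩ := hC ((|C| + 1) / ε)
    obtain ⟨l, hl, rfl⟩ := tm_list S hS p hp
    have hge : ∀ x, 1 ≤ (l.map tmW).sum x := by
      intro x
      have a1 := (abs_le.1 (hpC x)).2
      have a2 : |C| + 1 ≤ (|C| + 1) / ε * w x := by
        calc |C| + 1 = (|C| + 1) / ε * ε := by field_simp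
          _ ≤ _ := mul_le_mul_of_nonneg_left (hwε x) (by positivity)
      linarith [le_abs_self C]
    refine hlist l ?_ hl hge
    by_contra hlen
    have : l = [] := by
      rw [← List.length_eq_zero_iff]; omega
    subst this
    obtain ⟨x⟩ := hX
    have := hge x
    norm_num at this
end

section
/- Let S be a pseudogroup on a set X. Then S admits an invariant mean if and only if S is not strongly paradoxical; that is, exactly one of the following holds: S has an invariant mean, or S is strongly paradoxical (the Tarski alternative). -/
open Set

/-- `S` is strongly paradoxical. -/
def StronglyParadoxical {X : Type*} (S : Set (Set (X × X))) : Prop :=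
  ∃ a ∈ S, ∃ b ∈ S, pdom a = Set.univ ∧ pdom b = Set.univ ∧
    pran a ∩ pran b = ∅ ∧ pran a ∪ pran b = Set.univ

namespace TarskiAlt

variable {X : Type*} {S : Set (Set (X × X))}

lemma restrict_mem (hS : IsPseudogroup S) {r : Set (X × X)} (hr : r ∈ S) (g : Set (X × X))
    (hg : g ⊆ r) : g ∈ S := by
  have h := hS.comp_mem r hr _ (hS.id_mem (pdom g))
  have e : pcomp r (pid (pdom g)) = g := by
    ext ⟨x, y⟩
    constructor
    · rintro ⟨z, ⟨⟨y', hy'⟩, hz⟩, hzy⟩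
      have hz' : z = x := hz
      subst hz'
      have := (hS.partialBij r hr).1 (hg hy') hzy
      have h2 : y' = y := this
      subst h2
      exact hy'
    · intro hxy
      exact ⟨x, ⟨⟨y, hxy⟩, rfl⟩, hg hxy⟩
  rwa [e] at h

lemma piecewise_mem (hS : IsPseudogroup S) {K : Set (Set (X × X))} (hK : K.Finite) :
    K ⊆ S → ∀ g : Set (X × X), IsPartialBij g → (∀ p ∈ g, ∃ r ∈ K, p ∈ r) → g ∈ S := by
  induction K, hK using Set.Finite.induction_on with
  | empty =>
    intro _ g _ h
    refine restrict_mem hS (hS.id_mem ∅) g ?_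
    intro p hp
    obtain ⟨r, hr, _⟩ := h p hp
    exact absurd hr (Set.notMem_empty r)
  | @insert r K _ _ ih =>
    intro hKS g hg h
    have h1 : g ∩ r ∈ S := restrict_mem hS (hKS (mem_insert r K)) _ inter_subset_right
    have h2 : g \ r ∈ S := by
      apply ih ((subset_insert r K).trans hKS)
      · exact ⟨fun x y y' a b => hg.1 a.1 b.1, fun x x' y a b => hg.2 a.1 b.1⟩
      · rintro p ⟨hp, hpr⟩
        obtain ⟨r', hr', hpr'⟩ := h p hp
        rcases hr' with rfl | hr'
        · exact absurd hpr' hpr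
        · exact ⟨r', hr', hpr'⟩
    have h3 := hS.union_mem _ h1 _ h2 ?_ ?_
    · rwa [inter_union_diff] at h3
    · rw [Set.disjoint_left]
      rintro x ⟨y, hy⟩ ⟨y', hy'⟩
      have := hg.1 hy.1 hy'.1
      subst this
      exact hy'.2 hy.2
    · rw [Set.disjoint_left]
      rintro x ⟨y, hy⟩ ⟨y', hy'⟩
      have := hg.2 hy.1 hy'.1
      subst this
      exact hy'.2 hy.2

/-- Schröder–Bernstein step: a paradoxical decomposition may be made exact. -/
lemma strong_of_weak (hS : IsPseudogroup S) (f g : X → X) (hf : Function.Injective f)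
    (hg : Function.Injective g) (hd : ∀ x y, f x ≠ g y)
    (hfS : {p : X × X | p.2 = f p.1} ∈ S) (hgS : {p : X × X | p.2 = g p.1} ∈ S) :
    StronglyParadoxical S := by
  set C : Set X := {x | ∃ n : ℕ, ∃ z, x = g^[n] (f z)} with hC
  have hCg : ∀ x ∈ C, g x ∈ C := by
    rintro x ⟨n, z, rfl⟩
    exact ⟨n + 1, z, by rw [Function.iterate_succ_apply']⟩
  have hCf : ∀ x, f x ∈ C := fun x => ⟨0, x, rfl⟩
  set b : Set (X × X) := {p | (p.1 ∈ C ∧ p.2 = g p.1) ∨ (p.1 ∉ C ∧ p.2 = p.1)} with hb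
  have hbS : b ∈ S := by
    apply piecewise_mem hS (K := {{p : X × X | p.2 = g p.1}, pid univ}) (by simp)
    · rintro r (rfl | rfl)
      · exact hgS
      · exact hS.id_mem _
    · constructor
      · rintro x y y' (⟨h1, h2⟩ | ⟨h1, h2⟩) (⟨h3, h4⟩ | ⟨h3, h4⟩) <;> simp_all
      · rintro x x' y (⟨h1, h2⟩ | ⟨h1, h2⟩) (⟨h3, h4⟩ | ⟨h3, h4⟩) <;> simp only at h1 h2 h3 h4
        · exact hg (h2.symm.trans h4)
        · exact absurd (h4 ▸ h2 ▸ hCg _ h1) h3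
        · exact absurd (h2 ▸ h4 ▸ hCg _ h3) h1
        · exact h2.symm.trans h4
    · rintro p (⟨h1, h2⟩ | ⟨h1, h2⟩)
      · exact ⟨_, Or.inl rfl, h2⟩
      · exact ⟨_, Or.inr rfl, trivial, h2⟩
  refine ⟨_, hfS, b, hbS, ?_, ?_, ?_, ?_⟩
  · ext x; simp [pdom]
  · ext x
    by_cases h : x ∈ C <;> simp [pdom, hb, h]
  · ext y
    simp only [mem_inter_iff, mem_empty_iff_false, iff_false]
    rintro ⟨⟨x, hx⟩, ⟨z, (⟨h1, h2⟩ | ⟨h1, h2⟩)⟩⟩ <;> simp only [mem_setOf_eq] at hx h1 h2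
    · exact hd x z (hx.symm.trans h2)
    · subst h2; exact h1 (hx ▸ hCf x)
  · ext y
    simp only [mem_union, mem_univ, iff_true]
    by_cases h : y ∈ C
    · obtain ⟨n, z, rfl⟩ := h
      cases n with
      | zero => exact Or.inl ⟨z, rfl⟩
      | succ n =>
        refine Or.inr ⟨g^[n] (f z), Or.inl ⟨⟨n, z, rfl⟩, ?_⟩⟩
        simp [Function.iterate_succ_apply']
    · exact Or.inr ⟨y, Or.inr ⟨h, rfl⟩⟩

/-- A finite-valued map controlled by finitely many elements of `S`. -/
def Bd (S : Set (Set (X × X))) (T : X → Finset X) : Prop :=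
  ∃ K : Set (Set (X × X)), K.Finite ∧ K ⊆ S ∧ ∀ x, ∀ y ∈ T x, ∃ r ∈ K, (x, y) ∈ r

open Classical in
lemma small_doubling (hS : IsPseudogroup S) (hn : ¬ StronglyParadoxical S) {T : X → Finset X}
    (hT : Bd S T) : ∃ F : Finset X, (F.biUnion T).card < 2 * F.card := by
  by_contra! hcon
  apply hn
  obtain ⟨φ, hφ, hφT⟩ := (Finset.all_card_le_biUnion_card_iff_exists_injective
    (fun p : X × Bool => T p.1)).1 (by
      intro s
      have h1 : s.card ≤ 2 * (s.image Prod.fst).card := by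
        have : s ⊆ (s.image Prod.fst) ×ˢ (Finset.univ : Finset Bool) := by
          intro p hp
          simp only [Finset.mem_product, Finset.mem_univ, and_true]
          exact Finset.mem_image_of_mem _ hp
        have := Finset.card_le_card this
        rw [Finset.card_product] at this
        simpa [mul_comm] using this
      refine h1.trans ((hcon _).trans ?_)
      rw [Finset.image_biUnion])
  obtain ⟨K, hKf, hKS, hK⟩ := hT
  have hmem : ∀ c : Bool, {p : X × X | p.2 = φ (p.1, c)} ∈ S := by
    intro c
    apply piecewise_mem hS hKf hKS
    · constructor
      · intro x y y' h h'
        exact Eq.trans h (Eq.symm h')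
      · intro x x' y h h'
        have := hφ (Eq.trans (Eq.symm h) h')
        simpa using this
    · rintro ⟨x, y⟩ h
      have h' : y = φ (x, c) := h
      subst h'
      exact hK x _ (hφT (x, c))
  refine strong_of_weak hS (fun x => φ (x, true)) (fun x => φ (x, false)) ?_ ?_ ?_
    (hmem true) (hmem false)
  · intro x y h; simpa using hφ h
  · intro x y h; simpa using hφ h
  · intro x y h; simpa using hφ h

open Classical in
/-- Iterates of a finite-valued map. -/
noncomputable def iter (T : X → Finset X) : ℕ → X → Finset X
  | 0 => fun x => {x}
  | n + 1 => fun x => (iter T n x).biUnion T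

lemma bd_iter (hS : IsPseudogroup S) {T : X → Finset X} (hT : Bd S T) (n : ℕ) :
    Bd S (iter T n) := by
  induction n with
  | zero =>
    refine ⟨{pid univ}, by simp, by simpa using hS.id_mem _, ?_⟩
    intro x y hy
    exact ⟨_, rfl, trivial, by simpa [iter] using hy⟩
  | succ n ih =>
    obtain ⟨K, hKf, hKS, hK⟩ := hT
    obtain ⟨L, hLf, hLS, hL⟩ := ih
    refine ⟨Set.image2 pcomp K L, hKf.image2 _ hLf, ?_, ?_⟩
    · rintro _ ⟨r, hr, s, hs, rfl⟩
      exact hS.comp_mem _ (hKS hr) _ (hLS hs)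
    · intro x y hy
      simp only [iter, Finset.mem_biUnion] at hy
      obtain ⟨z, hz, hy⟩ := hy
      obtain ⟨s, hs, hs'⟩ := hL x z hz
      obtain ⟨r, hr, hr'⟩ := hK z y hy
      exact ⟨_, ⟨r, hr, s, hs, rfl⟩, z, hs', hr'⟩

open Classical in
lemma folner (hS : IsPseudogroup S) (hn : ¬ StronglyParadoxical S) {T : X → Finset X}
    (hT : Bd S T) {ε : ℝ} (hε : 0 < ε) :
    ∃ F : Finset X, ((F.biUnion T).card : ℝ) < (1 + ε) * F.card := by
  by_contra! hcon
  obtain ⟨n, hn2⟩ := pow_unbounded_of_one_lt 2 (show 1 < 1 + ε by linarith)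
  obtain ⟨F, hF⟩ := small_doubling hS hn (bd_iter hS hT n)
  have key : ∀ m : ℕ, (1 + ε) ^ m * F.card ≤ ((F.biUnion (iter T m)).card : ℝ) := by
    intro m
    induction m with
    | zero => simp [iter]
    | succ m ih =>
      have e : F.biUnion (iter T (m + 1)) = (F.biUnion (iter T m)).biUnion T := by
        rw [Finset.biUnion_biUnion]; rfl
      rw [e]
      refine le_trans ?_ (hcon _)
      rw [pow_succ', mul_assoc]
      exact mul_le_mul_of_nonneg_left ih (by linarith)
  have h1 := key n
  have h2 : ((F.biUnion (iter T n)).card : ℝ) < 2 * F.card := by exact_mod_cast hF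
  have h3 : (2 : ℝ) * F.card ≤ (1 + ε) ^ n * F.card := by gcongr
  linarith

open Classical in
/-- Proportion of the finite set `F` lying in `A`. -/
noncomputable def dens (F : Finset X) (A : Set X) : ℝ :=
  ((F.filter (· ∈ A)).card : ℝ) / F.card

open Classical in
lemma almost_inv (hS : IsPseudogroup S) (hn : ¬ StronglyParadoxical S)
    (K : Finset S) {ε : ℝ} (hε : 0 < ε) :
    ∃ F : Finset X, F.Nonempty ∧ ∀ r ∈ K, dens F (pdom r.1) ≤ dens F (pran r.1) + ε := by
  have hfin : ∀ x, {y | y = x ∨ ∃ r ∈ K, (x, y) ∈ r.1}.Finite := by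
    intro x
    have : {y | y = x ∨ ∃ r ∈ K, (x, y) ∈ r.1} = {x} ∪ ⋃ r ∈ K, {y | (x, y) ∈ r.1} := by
      ext y; simp
    rw [this]
    refine (finite_singleton x).union (K.finite_toSet.biUnion fun r _ => ?_)
    exact Set.Subsingleton.finite fun y hy y' hy' => (hS.partialBij r.1 r.2).1 hy hy'
  set T : X → Finset X := fun x => (hfin x).toFinset with hT
  have hTm : ∀ x y, y ∈ T x ↔ (y = x ∨ ∃ r ∈ K, (x, y) ∈ r.1) := by
    intro x y; simp [hT]
  have hB : Bd S T := by
    refine ⟨insert (pid univ) (Subtype.val '' (K : Set S)),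
      ((K.finite_toSet.image _).insert _), ?_, ?_⟩
    · rintro r (rfl | ⟨r, _, rfl⟩)
      · exact hS.id_mem _
      · exact r.2
    · intro x y hy
      rcases (hTm x y).1 hy with rfl | ⟨r, hr, h⟩
      · exact ⟨_, mem_insert _ _, trivial, rfl⟩
      · exact ⟨r.1, Or.inr ⟨r, hr, rfl⟩, h⟩
  obtain ⟨F, hF⟩ := folner hS hn hB hε
  have hne : F.Nonempty := by
    rw [Finset.nonempty_iff_ne_empty]
    rintro rfl
    simp at hF
  have hpos : (0 : ℝ) < F.card := by exact_mod_cast hne.card_pos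
  refine ⟨F, hne, fun r hr => ?_⟩
  have hsub : F ⊆ F.biUnion T := by
    intro x hx
    exact Finset.mem_biUnion.2 ⟨x, hx, (hTm x x).2 (Or.inl rfl)⟩
  have hc : (F.filter (· ∈ pdom r.1)).card ≤
      (F.filter (· ∈ pran r.1) ∪ (F.biUnion T \ F)).card := by
    have hex : ∀ x ∈ pdom r.1, ∃ y, (x, y) ∈ r.1 := fun x hx => hx
    choose! f hf using hex
    refine Finset.card_le_card_of_injOn f ?_ ?_
    · intro x hx
      have hx' := Finset.mem_filter.1 hx
      have h := hf x hx'.2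
      by_cases hfF : f x ∈ F
      · exact Finset.mem_union_left _ (Finset.mem_filter.2 ⟨hfF, x, h⟩)
      · exact Finset.mem_union_right _ (Finset.mem_sdiff.2
          ⟨Finset.mem_biUnion.2 ⟨x, hx'.1, (hTm _ _).2 (Or.inr ⟨r, hr, h⟩)⟩, hfF⟩)
    · intro x hx y hy hxy
      have h1 := hf x (Finset.mem_filter.1 hx).2
      have h2 := hf y (Finset.mem_filter.1 hy).2
      rw [← hxy] at h2
      exact (hS.partialBij r.1 r.2).2 h1 h2
  have hc2 := hc.trans (Finset.card_union_le _ _)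
  have hs := Finset.card_sdiff_add_card_eq_card hsub
  have hc3 : ((F.filter (· ∈ pdom r.1)).card : ℝ) ≤
      (F.filter (· ∈ pran r.1)).card + (F.biUnion T \ F).card := by exact_mod_cast hc2
  have hs2 : ((F.biUnion T \ F).card : ℝ) + F.card = (F.biUnion T).card := by exact_mod_cast hs
  unfold dens
  rw [div_add' _ _ _ hpos.ne']
  gcongr
  linarith

lemma dens_mem (F : Finset X) (A : Set X) : dens F A ∈ Set.Icc (0 : ℝ) 1 := by
  classical
  unfold dens
  constructor
  · positivity
  · apply div_le_one_of_le₀ _ (by positivity)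
    exact_mod_cast Finset.card_filter_le _ _

lemma dens_union (F : Finset X) (A B : Set X) (h : Disjoint A B) :
    dens F (A ∪ B) = dens F A + dens F B := by
  classical
  unfold dens
  rw [← add_div]
  congr 1
  norm_cast
  rw [← Finset.card_union_of_disjoint]
  · congr 1
    ext x
    simp only [Finset.mem_filter, Finset.mem_union, Set.mem_union]
    tauto
  · rw [Finset.disjoint_left]
    intro x hx hy
    exact Set.disjoint_left.1 h (Finset.mem_filter.1 hx).2 (Finset.mem_filter.1 hy).2

lemma exists_mean (hS : IsPseudogroup S) (hn : ¬ StronglyParadoxical S) :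
    ∃ μ : Set X → ℝ, IsInvariantMean S μ := by
  classical
  have hA := fun i : Finset S × ℕ => almost_inv hS hn i.1 (Nat.one_div_pos_of_nat (α := ℝ) (n := i.2))
  choose F hne hF using hA
  let U : Ultrafilter (Finset S × ℕ) := Ultrafilter.of Filter.atTop
  have hU : (U : Filter (Finset S × ℕ)) ≤ Filter.atTop := Ultrafilter.of_le _
  have hlim : ∀ A : Set X, ∃ m ∈ Set.Icc (0 : ℝ) 1,
      Filter.Tendsto (fun i => dens (F i) A) U (nhds m) := by
    intro A
    obtain ⟨m, hm, h⟩ := (isCompact_Icc (a := (0 : ℝ)) (b := 1)).ultrafilter_le_nhds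
      (U.map fun i => dens (F i) A) (by
        rw [Filter.le_principal_iff]
        exact Filter.Eventually.of_forall (f := (U : Filter (Finset S × ℕ))) fun i => dens_mem (F i) A)
    exact ⟨m, hm, h⟩
  choose μ hμ hμt using hlim
  have hle : ∀ r ∈ S, μ (pdom r) ≤ μ (pran r) := by
    intro r hr
    have h0 : Filter.Tendsto (fun i : Finset S × ℕ => 1 / ((i.2 : ℝ) + 1)) U (nhds 0) := by
      have : Filter.Tendsto (fun i : Finset S × ℕ => i.2) Filter.atTop Filter.atTop := by
        rw [← Filter.prod_atTop_atTop_eq]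
        exact Filter.tendsto_snd
      exact (tendsto_one_div_add_atTop_nhds_zero_nat.comp this).mono_left hU
    have h1 := (hμt (pran r)).add h0
    rw [add_zero] at h1
    refine le_of_tendsto_of_tendsto (hμt (pdom r)) h1 ?_
    have hev : ∀ᶠ i : Finset S × ℕ in (U : Filter (Finset S × ℕ)), ({⟨r, hr⟩}, 0) ≤ i :=
      hU (Filter.eventually_ge_atTop _)
    filter_upwards [hev] with i hi
    exact hF i ⟨r, hr⟩ (hi.1 (Finset.mem_singleton_self _))
  refine ⟨μ, fun A => (hμ A).1, ?_, ?_, ?_⟩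
  · refine tendsto_nhds_unique (hμt univ) ?_
    refine tendsto_const_nhds.congr fun i => ?_
    have : ((F i).card : ℝ) ≠ 0 := by exact_mod_cast (hne i).card_pos.ne'
    simp [dens, this]
  · intro A B hAB
    refine tendsto_nhds_unique (hμt (A ∪ B)) ?_
    refine ((hμt A).add (hμt B)).congr fun i => ?_
    rw [dens_union _ _ _ hAB]
  · intro r hr
    exact le_antisymm (hle r hr) (hle (pinv r) (hS.inv_mem r hr))

end TarskiAlt

/-- The Tarski alternative: a pseudogroup admits an invariant mean iff it is not strongly
paradoxical. -/
theorem invariantMean_iff_not_stronglyParadoxical {X : Type*} (S : Set (Set (X × X)))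
    (hS : IsPseudogroup S) :
    (∃ μ : Set X → ℝ, IsInvariantMean S μ) ↔ ¬ StronglyParadoxical S := by
  constructor
  · rintro ⟨μ, _, h1, hadd, hinv⟩ ⟨a, ha, b, hb, hda, hdb, hdis, hun⟩
    have ea := hinv a ha
    have eb := hinv b hb
    have := hadd _ _ (Set.disjoint_iff_inter_eq_empty.2 hdis)
    rw [hun, ← ea, ← eb, hda, hdb, h1] at this
    norm_num at this
  · exact TarskiAlt.exists_mean hS
end

section
/- Let T be a commutative monoid, written additively, and let u ∈ T be an order-unit. Then there exists a morphism from T to [0, ∞) normalized at u if and only if for every natural number n ≥ 0 it is not the case that (n+1)u ≤ nu (Tarski's theorem). -/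
theorem tarski_total {G : Type*} [AddCommGroup G] (P₀ : AddSubmonoid G) (u : G)
    (hu : u ∈ P₀) (hnu : -u ∉ P₀) :
    ∃ P : AddSubmonoid G, P₀ ≤ P ∧ -u ∉ P ∧ ∀ g, g ∈ P ∨ -g ∈ P := by
  obtain ⟨P, hP0, hmax⟩ := zorn_le_nonempty₀ {P : AddSubmonoid G | -u ∉ P} (by
    intro c hc hchain y hy
    refine ⟨sSup c, ?_, fun z hz => le_sSup hz⟩
    intro h
    rw [AddSubmonoid.mem_sSup_of_directedOn ⟨y, hy⟩ hchain.directedOn] at h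
    obtain ⟨s, hs, h⟩ := h
    exact hc hs h) P₀ hnu
  have key : ∀ g, g ∉ P → ∃ p ∈ P, ∃ n : ℕ, p + n • g = -u := by
    intro g hg
    by_contra hcon
    have h1 : -u ∉ P ⊔ AddSubmonoid.multiples g := by
      intro h
      obtain ⟨p, hp, z, hz, he⟩ := AddSubmonoid.mem_sup.1 h
      obtain ⟨n, rfl⟩ := AddSubmonoid.mem_multiples_iff _ _ |>.1 hz
      exact hcon ⟨p, hp, n, he⟩
    have h2 := hmax.2 h1 le_sup_left
    exact hg (h2 (AddSubmonoid.mem_sup_right (AddSubmonoid.mem_multiples g)))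
  have hP : -u ∉ P := hmax.1
  refine ⟨P, hP0, hP, fun g => ?_⟩
  by_contra! hg
  obtain ⟨p, hp, n, h1⟩ := key g hg.1
  obtain ⟨q, hq, m, h2⟩ := key (-g) hg.2
  have huP : u ∈ P := hP0 hu
  rcases n with _ | n
  · apply hP; rw [← h1]; simpa using hp
  have : -u = (m • p + (n+1) • q) + (m + n) • u := by
    have e1 : p = -u - (n+1) • g := by rw [← h1]; abel
    have e2 : q = -u + m • g := by rw [← h2]; simp
    rw [e1, e2]
    module
  apply hP
  rw [this]
  exact add_mem (add_mem (nsmul_mem hp _) (nsmul_mem hq _)) (nsmul_mem huP _)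

theorem tarski_group {G : Type*} [AddCommGroup G] (P₀ : AddSubmonoid G) (u : G)
    (hu : u ∈ P₀) (hnu : -u ∉ P₀) 
    (hb : ∀ g, ∃ m : ℕ, g + m • u ∈ P₀) :
    ∃ φ : G → ℝ, (∀ a ∈ P₀, 0 ≤ φ a) ∧ φ 0 = 0 ∧
      (∀ a b, φ (a + b) = φ a + φ b) ∧ φ u = 1 := by
  obtain ⟨P, hP0, hP, htot⟩ := tarski_total P₀ u hu hnu
  have huP : u ∈ P := hP0 hu
  have hz : ∀ k : ℤ, k • u ∈ P → 0 ≤ k := by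
    intro k hk
    by_contra! hlt
    obtain ⟨j, rfl⟩ : ∃ j : ℕ, k = -(j+1) := ⟨(-k-1).toNat, by omega⟩
    apply hP
    have : -u = (-((j:ℤ)+1)) • u + j • u := by module
    rw [this]
    exact add_mem hk (nsmul_mem huP _)
  let S : G → Set ℝ := fun g => {x | ∃ (p : ℤ) (q : ℕ), 0 < q ∧ x = p / q ∧ p • u - q • g ∈ P}
  have hlow : ∀ g (m : ℕ), g + m • u ∈ P → ∀ x ∈ S g, -(m:ℝ) ≤ x := by
    rintro g m hm x ⟨p, q, hq, rfl, h⟩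
    have h1 : (p + q * m) • u ∈ P := by
      have : (p + q * m) • u = (p • u - q • g) + q • (g + m • u) := by module
      rw [this]
      exact add_mem h (nsmul_mem hm _)
    have h2 : (0:ℝ) ≤ p + q * m := by exact_mod_cast hz _ h1
    rw [le_div_iff₀ (by exact_mod_cast hq)]
    linarith
  have hbdd : ∀ g, BddBelow (S g) := by
    intro g
    obtain ⟨m, hm⟩ := hb g
    exact ⟨_, fun x hx => hlow g m (hP0 hm) x hx⟩
  have hne : ∀ g, (S g).Nonempty := by
    intro g
    obtain ⟨m, hm⟩ := hb (-g)
    refine ⟨m, m, 1, one_pos, by simp, ?_⟩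
    have := hP0 hm
    convert this using 1
    module
  let φ : G → ℝ := fun g => sInf (S g)
  have hle : ∀ g x, x ∈ S g → φ g ≤ x := fun g x hx => csInf_le (hbdd g) hx
  have hpos : ∀ g ∈ P, 0 ≤ φ g := by
    intro g hg
    refine le_csInf (hne g) fun x hx => ?_
    simpa using hlow g 0 (by simpa using hg) x hx
  have h0 : φ 0 = 0 := by
    refine le_antisymm (hle _ _ ⟨0, 1, one_pos, by simp, by simp⟩) (hpos _ (zero_mem _))
  have hsub : ∀ a b, φ (a + b) ≤ φ a + φ b := by
    intro a b
    have : ∀ x ∈ S a, ∀ y ∈ S b, φ (a + b) ≤ x + y := by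
      rintro x ⟨p, q, hq, rfl, h⟩ y ⟨p2, q2, hq2, rfl, h2⟩
      refine hle _ _ ⟨p * q2 + p2 * q, q * q2, by positivity, ?_, ?_⟩
      · push_cast
        field_simp
      · have : (p * q2 + p2 * q) • u - (q * q2) • (a + b)
          = q2 • (p • u - q • a) + q • (p2 • u - q2 • b) := by module
        rw [this]
        exact add_mem (nsmul_mem h _) (nsmul_mem h2 _)
    have h1 : ∀ x ∈ S a, φ (a + b) - x ≤ φ b := fun x hx =>
      le_csInf (hne b) fun y hy => by linarith [this x hx y hy]
    have h2 : φ (a + b) - φ b ≤ φ a := le_csInf (hne a) fun x hx => by linarith [h1 x hx]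
    linarith
  have hneg : ∀ g, φ g + φ (-g) ≤ 0 := by
    intro g
    by_contra! hlt
    obtain ⟨r, hr1, hr2⟩ := exists_rat_btwn (show -φ (-g) < φ g by linarith)
    have hr : (r : ℝ) = r.num / r.den := by exact_mod_cast (Rat.num_div_den r).symm
    rcases htot (r.num • u - r.den • g) with h | h
    · have := hle g r ⟨r.num, r.den, r.pos, hr, h⟩
      linarith
    · have := hle (-g) (-r) ⟨-r.num, r.den, r.pos, by rw [hr]; push_cast; ring, by
        convert h using 1
        module⟩
      linarith
  refine ⟨φ, fun a ha => hpos a (hP0 ha), h0, fun a b => ?_, ?_⟩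
  · have h1 := hsub (a + b) (-b)
    rw [add_neg_cancel_right] at h1
    linarith [hneg b, hsub a b]
  · refine le_antisymm (hle _ _ ⟨1, 1, one_pos, by simp, by simp⟩) (le_csInf (hne u) ?_)
    rintro x ⟨p, q, hq, rfl, h⟩
    have h1 : (p - q) • u ∈ P := by
      convert h using 1
      module
    have h2 : (0:ℝ) ≤ p - q := by exact_mod_cast hz _ h1
    rw [le_div_iff₀ (by exact_mod_cast hq)]
    linarith

/-- Tarski's theorem: a commutative monoid `T` with order-unit `u` admits a morphism to
`[0, ∞)` normalized at `u` iff for no `n : ℕ` does `(n+1)u ≤ nu` hold in the algebraic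
preorder. -/
theorem tarski_theorem {T : Type*} [AddCommMonoid T] (u : T)
    (hu : ∀ a : T, ∃ n : ℕ, 1 ≤ n ∧ ∃ c : T, n • u = a + c) :
    (∃ φ : T → ℝ, (∀ a, 0 ≤ φ a) ∧ φ 0 = 0 ∧
      (∀ a b, φ (a + b) = φ a + φ b) ∧ φ u = 1) ↔
    ∀ n : ℕ, ¬ ∃ c : T, n • u = (n + 1) • u + c := by
  constructor
  · rintro ⟨φ, h0, hz, hadd, h1⟩ n ⟨c, hc⟩
    have := congrArg φ hc
    rw [hadd, succ_nsmul, hadd] at this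
    linarith [h0 c]
  · intro H
    let ι : T →+ Algebra.GrothendieckAddGroup T := Algebra.GrothendieckAddGroup.of
    have hι : ∀ a b, ι a = ι b → ∃ d, d + a = d + b := by
      intro a b h
      obtain ⟨d, hd⟩ := (AddLocalization.addMonoidOf (⊤ : AddSubmonoid T)).eq_iff_exists.1 h
      exact ⟨d, hd⟩
    obtain ⟨φ, h1, h2, h3, h4⟩ := tarski_group (AddMonoidHom.mrange ι) (ι u) ⟨u, rfl⟩ (by
      rintro ⟨c, hc⟩
      obtain ⟨d, hd⟩ := hι (u + c) 0 (by rw [map_add, hc, map_zero]; simp)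
      obtain ⟨m, -, e, he⟩ := hu d
      refine H m ⟨c, ?_⟩
      calc m • u = (d + 0) + e := by rw [he, add_zero]
        _ = (d + e) + u + c := by rw [← hd]; abel
        _ = (m + 1) • u + c := by rw [← he, succ_nsmul]) (by
      intro g
      obtain ⟨⟨a, b⟩, hab⟩ := (AddLocalization.addMonoidOf (⊤ : AddSubmonoid T)).surj g
      replace hab : g + ι b = ι a := hab
      obtain ⟨m, -, e, he⟩ := hu b
      refine ⟨m, a + e, ?_⟩
      rw [← map_nsmul, he, map_add, map_add, ← hab]
      abel)
    exact ⟨fun a => φ (ι a), fun a => h1 _ ⟨a, rfl⟩, by simpa using h2,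
      fun a b => by simp [h3], h4⟩
end

section
/- Let E be a set partitioned as E = M ∪ N with M ∩ N = ∅ together with a bijection φ : M → N; let E′ be a set partitioned as E′ = P ∪ Q with P ∩ Q = ∅ together with a bijection ψ : P → Q; and let α : E → E′ be a bijection. Form the disjoint union Z = E ⊔ E′ and regard φ, ψ and α as partial bijections of Z. Then every pseudogroup on Z containing φ, ψ and α contains an element h with dom h = M and ran h = Q; in particular, there is a bijection from M onto Q (Kuratowski's theorem). -/
open Set

theorem hall_two {X Y : Type*} (f : X × Bool → Y × Bool) (hf : Function.Injective f) :
    ∃ k : X → Y, Function.Injective k ∧ ∀ x, ∃ b c, f (x, b) = (k x, c) := by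
  classical
  have key := (Finset.all_card_le_biUnion_card_iff_exists_injective
    (fun x : X => ({(f (x, false)).1, (f (x, true)).1} : Finset Y))).1 (by
      intro s
      have h1 : (s ×ˢ (Finset.univ : Finset Bool)).card ≤
          ((s.biUnion (fun x : X => ({(f (x, false)).1, (f (x, true)).1} : Finset Y))) ×ˢ
            (Finset.univ : Finset Bool)).card := by
        apply Finset.card_le_card_of_injOn f _ hf.injOn
        rintro ⟨x, b⟩ hx
        have hxs : x ∈ s := by simpa using hx
        simp only [Finset.coe_product, Set.mem_prod, Finset.mem_coe, Finset.mem_univ, and_true,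
          Finset.mem_biUnion]
        refine ⟨x, hxs, ?_⟩
        cases b <;> simp
      simp only [Finset.card_product, Finset.card_univ, Fintype.card_bool] at h1
      omega)
  obtain ⟨k, hk, hm⟩ := key
  refine ⟨k, hk, fun x => ?_⟩
  have := hm x
  simp only [Finset.mem_insert, Finset.mem_singleton] at this
  rcases this with h | h
  · exact ⟨false, (f (x, false)).2, by rw [h]⟩
  · exact ⟨true, (f (x, true)).2, by rw [h]⟩

theorem glue {Z : Type*} {S : Set (Set (Z × Z))} (hS : IsPseudogroup S)
    {I : Type*} [DecidableEq I] (M : Set Z) (h : Z → Z) (hh : Set.InjOn h M) (R : I → Set (Z × Z))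
    (hR : ∀ i, R i ∈ S) (c : Z → I) (hc : ∀ x ∈ M, (x, h x) ∈ R (c x)) (D : Finset I) :
    {p : Z × Z | p.1 ∈ M ∧ c p.1 ∈ D ∧ p.2 = h p.1} ∈ S := by
  induction D using Finset.induction_on with
  | empty =>
    convert hS.id_mem ∅ using 1
    ext p; simp [pid]
  | insert i D hi ih =>
    have h1 := hS.comp_mem _ (hR i) _ (hS.id_mem {x | x ∈ M ∧ c x = i})
    have e : pcomp (R i) (pid {x | x ∈ M ∧ c x = i}) =
        {p : Z × Z | p.1 ∈ M ∧ c p.1 = i ∧ p.2 = h p.1} := by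
      ext ⟨x, y⟩
      simp only [pcomp, pid, Set.mem_setOf_eq]
      constructor
      · rintro ⟨z, ⟨⟨hx, hxi⟩, rfl⟩, hz⟩
        have := hc _ hx
        rw [hxi] at this
        exact ⟨hx, hxi, (hS.partialBij _ (hR i)).1 hz this⟩
      · rintro ⟨hx, rfl, rfl⟩
        exact ⟨x, ⟨⟨hx, rfl⟩, rfl⟩, hc x hx⟩
    rw [e] at h1
    have h2 := hS.union_mem _ h1 _ ih (by
      rw [Set.disjoint_left]
      rintro x ⟨y, hx, hxi, -⟩ ⟨y', -, hxD, -⟩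
      simp only at hxi hxD
      exact hi (hxi ▸ hxD)) (by
      rw [Set.disjoint_left]
      rintro y ⟨x, hx, hxi, hy⟩ ⟨x', hx', hxD, hy'⟩
      simp only at hx hxi hy hx' hxD hy'
      have := hh hx hx' (hy.symm.trans hy')
      subst this
      exact hi (hxi ▸ hxD))
    convert h2 using 1
    ext p
    simp only [Finset.mem_insert, Set.mem_setOf_eq, Set.mem_union]
    tauto

/-- Kuratowski's theorem: with `Z = E ⊔ E'`, `E = M ⊔ N`, `E' = P ⊔ Q`, a bijection
`φ : M → N`, a bijection `ψ : P → Q` and a bijection `α : E → E'`, every pseudogroup on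
`Z` containing `φ`, `ψ` and `α` contains an element with domain `M` and range `Q`. -/
theorem kuratowski {Z : Type*} (M N P Q : Set Z)
    (hMN : Disjoint M N) (hPQ : Disjoint P Q)
    (hEE' : Disjoint (M ∪ N) (P ∪ Q)) (hZ : (M ∪ N) ∪ (P ∪ Q) = Set.univ)
    (φ ψ α : Set (Z × Z))
    (hφ : IsPartialBij φ) (hφd : pdom φ = M) (hφr : pran φ = N)
    (hψ : IsPartialBij ψ) (hψd : pdom ψ = P) (hψr : pran ψ = Q)
    (hα : IsPartialBij α) (hαd : pdom α = M ∪ N) (hαr : pran α = P ∪ Q)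
    (S : Set (Set (Z × Z))) (hS : IsPseudogroup S)
    (hφS : φ ∈ S) (hψS : ψ ∈ S) (hαS : α ∈ S) :
    ∃ h ∈ S, pdom h = M ∧ pran h = Q := by
  classical
  subst hφd hφr hψd hψr
  let A : Bool → Set (Z × Z) := fun b => if b then φ else pid (pdom φ)
  let B : Bool → Set (Z × Z) := fun b => if b then ψ else pid (pran ψ)
  have hA : ∀ b, A b ∈ S := by
    intro b; cases b
    · exact hS.id_mem _
    · exact hφS
  have hB : ∀ b, B b ∈ S := by
    intro b; cases b
    · exact hS.id_mem _
    · exact hψS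
  have hAd : ∀ b x y, (x, y) ∈ A b → x ∈ pdom φ := by
    intro b x y h; cases b
    · exact h.1
    · exact ⟨y, h⟩
  have hBr : ∀ b x y, (x, y) ∈ B b → y ∈ pran ψ := by
    intro b x y h; cases b
    · have h2 : y = x := h.2
      rw [h2]; exact h.1
    · exact ⟨x, h⟩
  have hAt : ∀ b, ∀ x ∈ pdom φ, ∃ y ∈ pdom φ ∪ pran φ, (x, y) ∈ A b := by
    intro b x h; cases b
    · exact ⟨x, Or.inl h, h, rfl⟩
    · obtain ⟨y, hy⟩ := h
      exact ⟨y, Or.inr ⟨x, hy⟩, hy⟩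
  have hBt : ∀ b, ∀ y ∈ pran ψ, ∃ x ∈ pdom ψ ∪ pran ψ, (x, y) ∈ B b := by
    intro b x h; cases b
    · exact ⟨x, Or.inr h, h, rfl⟩
    · obtain ⟨y, hy⟩ := h
      exact ⟨y, Or.inl ⟨x, hy⟩, hy⟩
  have hAs : ∀ y ∈ pdom φ ∪ pran φ, ∃ b x, (x, y) ∈ A b := by
    rintro y (h | ⟨x, h⟩)
    · exact ⟨false, y, h, rfl⟩
    · exact ⟨true, x, h⟩
  have hBs : ∀ x ∈ pdom ψ ∪ pran ψ, ∃ b y, (x, y) ∈ B b := by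
    rintro y (⟨x, h⟩ | h)
    · exact ⟨true, x, h⟩
    · exact ⟨false, y, h, rfl⟩
  have hAi : ∀ b b' x x' y, (x, y) ∈ A b → (x', y) ∈ A b' → b = b' := by
    have key : ∀ x x' y, (x, y) ∈ A false → (x', y) ∈ A true → False := by
      intro x x' y h h'
      have h2 : y = x := h.2
      subst h2
      exact Set.disjoint_left.1 hMN h.1 ⟨x', h'⟩
    intro b b' x x' y h h'
    cases b <;> cases b'
    · rfl
    · exact (key _ _ _ h h').elim
    · exact (key _ _ _ h' h).elim
    · rfl
  have hBi : ∀ b b' x y y', (x, y) ∈ B b → (x, y') ∈ B b' → b = b' := by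
    have key : ∀ x y y', (x, y) ∈ B false → (x, y') ∈ B true → False := by
      intro x x' y h h'
      exact Set.disjoint_left.1 hPQ ⟨_, h'⟩ h.1
    intro b b' x x' y h h'
    cases b <;> cases b'
    · rfl
    · exact (key _ _ _ h h').elim
    · exact (key _ _ _ h' h).elim
    · rfl
  let R : Bool × Bool → Set (Z × Z) := fun i => pcomp (B i.2) (pcomp α (A i.1))
  have hR : ∀ i, R i ∈ S := fun i =>
    hS.comp_mem _ (hB _) _ (hS.comp_mem _ hαS _ (hA _))
  have hf : ∀ p : (pdom φ) × Bool, ∃ q : (pran ψ) × Bool, ((p.1 : Z), (q.1 : Z)) ∈ R (p.2, q.2) := by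
    rintro ⟨⟨x, hx⟩, b⟩
    obtain ⟨e, he, hxe⟩ := hAt b x hx
    rw [← hαd] at he
    obtain ⟨e', hee⟩ := he
    have he' : e' ∈ pran α := ⟨e, hee⟩
    rw [hαr] at he'
    obtain ⟨c, y, hy⟩ := hBs e' he'
    exact ⟨(⟨y, hBr _ _ _ hy⟩, c), e', ⟨e, hxe, hee⟩, hy⟩
  have hg : ∀ q : (pran ψ) × Bool, ∃ p : (pdom φ) × Bool, ((p.1 : Z), (q.1 : Z)) ∈ R (p.2, q.2) := by
    rintro ⟨⟨y, hy⟩, c⟩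
    obtain ⟨e', he', hye⟩ := hBt c y hy
    rw [← hαr] at he'
    obtain ⟨e, hee⟩ := he'
    have he : e ∈ pdom α := ⟨e', hee⟩
    rw [hαd] at he
    obtain ⟨b, x, hx⟩ := hAs e he
    exact ⟨(⟨x, hAd _ _ _ hx⟩, b), e', ⟨e, hx, hee⟩, hye⟩
  choose f hf using hf
  choose g hg using hg
  have fi : Function.Injective f := by
    rintro ⟨⟨x, hx⟩, b⟩ ⟨⟨x', hx'⟩, b'⟩ h
    obtain ⟨e', ⟨e, h1, h2⟩, h3⟩ := hf (⟨x, hx⟩, b)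
    obtain ⟨d', ⟨d, k1, k2⟩, k3⟩ := hf (⟨x', hx'⟩, b')
    rw [← h] at k3
    obtain rfl := (hS.partialBij _ (hB _)).2 h3 k3
    obtain rfl := hα.2 h2 k2
    obtain rfl : b = b' := hAi _ _ _ _ _ h1 k1
    obtain rfl : x = x' := (hS.partialBij _ (hA _)).2 h1 k1
    rfl
  have gi : Function.Injective g := by
    rintro ⟨⟨x, hx⟩, b⟩ ⟨⟨x', hx'⟩, b'⟩ h
    obtain ⟨e', ⟨e, h1, h2⟩, h3⟩ := hg (⟨x, hx⟩, b)
    obtain ⟨d', ⟨d, k1, k2⟩, k3⟩ := hg (⟨x', hx'⟩, b')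
    rw [← h] at k1
    obtain rfl := (hS.partialBij _ (hA _)).1 h1 k1
    obtain rfl := hα.1 h2 k2
    obtain rfl : b = b' := hBi _ _ _ _ _ h3 k3
    obtain rfl : x = x' := (hS.partialBij _ (hB _)).1 h3 k3
    rfl
  obtain ⟨k, ki, hk⟩ := hall_two f fi
  obtain ⟨l, li, hl⟩ := hall_two g gi
  obtain ⟨h, hb, hh⟩ := Function.Embedding.schroeder_bernstein_of_rel ki li
    (fun x y => ∃ i, ((x : Z), (y : Z)) ∈ R i)
    (by
      intro x
      obtain ⟨b, c, e⟩ := hk x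
      have := hf (x, b)
      rw [e] at this
      exact ⟨_, this⟩)
    (by
      intro x
      obtain ⟨b, c, e⟩ := hl x
      have := hg (x, b)
      rw [e] at this
      exact ⟨_, this⟩)
  choose c hc using hh
  let h' : Z → Z := fun x => if hx : x ∈ pdom φ then h ⟨x, hx⟩ else x
  let c' : Z → Bool × Bool := fun x => if hx : x ∈ pdom φ then c ⟨x, hx⟩ else (true, true)
  have eh : ∀ x (hx : x ∈ pdom φ), h' x = h ⟨x, hx⟩ := fun x hx => dif_pos hx
  have ec : ∀ x (hx : x ∈ pdom φ), c' x = c ⟨x, hx⟩ := fun x hx => dif_pos hx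
  refine ⟨_, glue hS (pdom φ) h' ?_ R hR c' ?_ Finset.univ, ?_, ?_⟩
  · intro x hx y hy hxy
    rw [eh x hx, eh y hy] at hxy
    exact congrArg Subtype.val (hb.1 (Subtype.ext hxy))
  · intro x hx
    rw [eh x hx, ec x hx]
    exact hc _
  · ext x
    constructor
    · rintro ⟨y, hx, -⟩
      exact hx
    · intro hx
      exact ⟨h' x, hx, Finset.mem_univ _, rfl⟩
  · ext y
    constructor
    · rintro ⟨x, hx, -, hy⟩
      simp only at hx hy
      rw [hy, eh x hx]
      exact (h ⟨x, hx⟩).2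
    · intro hy
      obtain ⟨⟨x, hx⟩, e⟩ := hb.2 ⟨y, hy⟩
      refine ⟨x, hx, Finset.mem_univ _, ?_⟩
      simp only
      rw [eh x hx, e]
end

section
/- Every pseudogroup S on a set X satisfies the Kuratowski property: if E₁, E₂ ⊆ X are disjoint and some f ∈ S has dom f = E₁ and ran f = E₂; if F₁, F₂ ⊆ X are disjoint and some g ∈ S has dom g = F₁ and ran g = F₂; and if some h ∈ S has dom h = E₁ ∪ E₂ and ran h = F₁ ∪ F₂; then there exists k ∈ S with dom k = E₁ and ran k = F₂. -/
open Set

/-- Two fixed-point free involutions admit a common two-colouring. -/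
theorem exists_common_coloring {Y : Type*} (σ τ : Equiv.Perm Y)
    (hσ : ∀ x, σ (σ x) = x) (hτ : ∀ x, τ (τ x) = x)
    (hσ' : ∀ x, σ x ≠ x) (hτ' : ∀ x, τ x ≠ x) :
    ∃ A : Set Y, (∀ x, σ x ∈ A ↔ x ∉ A) ∧ (∀ x, τ x ∈ A ↔ x ∉ A) := by
  classical
  set ρ : Equiv.Perm Y := σ * τ with hρ
  have hσ2 : σ * σ = 1 := Equiv.ext hσ
  have hτ2 : τ * τ = 1 := Equiv.ext hτ
  have hσi : σ⁻¹ = σ := inv_eq_of_mul_eq_one_left hσ2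
  have hτi : τ⁻¹ = τ := inv_eq_of_mul_eq_one_left hτ2
  have hconj : σ * ρ * σ⁻¹ = ρ⁻¹ := by
    rw [hρ, mul_inv_rev, hσi, hτi, ← mul_assoc, hσ2, one_mul]
  have hcomm : ∀ (n : ℤ) x, σ ((ρ ^ n) x) = (ρ ^ (-n)) (σ x) := by
    intro n x
    have h1 : σ * ρ ^ n * σ⁻¹ = ρ ^ (-n) := by
      rw [← conj_zpow, hconj, inv_zpow, zpow_neg]
    have h2 : σ * ρ ^ n = ρ ^ (-n) * σ := by
      rw [← h1]; group
    exact congrArg (fun p : Equiv.Perm Y => p x) h2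
  have hτρ : ∀ x, τ x = σ (ρ x) := by
    intro x; simp [hρ, hσ]
  have hno : ∀ z, ¬ ρ.SameCycle z (σ z) := by
    rintro z ⟨n, hn⟩
    rcases Int.even_or_odd' n with ⟨m, rfl | rfl⟩
    · apply hσ' ((ρ ^ m) z)
      rw [hcomm, ← hn, ← Equiv.Perm.mul_apply, ← zpow_add]
      congr 2; ring
    · apply hτ' ((ρ ^ m) z)
      have : ρ ((ρ ^ m) z) = (ρ ^ (m + 1)) z := by
        rw [← Equiv.Perm.mul_apply, ← zpow_one_add, add_comm]
      rw [hτρ, this, hcomm, ← hn, ← Equiv.Perm.mul_apply, ← zpow_add]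
      congr 2; ring
  have hpres : ∀ {x y}, ρ.SameCycle x y → ρ.SameCycle (σ x) (σ y) := by
    rintro x y ⟨n, rfl⟩
    exact ⟨-n, (hcomm n x).symm⟩
  let s : Setoid Y :=
    { r := fun x y => ρ.SameCycle x y ∨ ρ.SameCycle (σ x) y
      iseqv := by
        refine ⟨fun x => Or.inl (Equiv.Perm.SameCycle.refl _ _), ?_, ?_⟩
        · rintro x y (h | h)
          · exact Or.inl h.symm
          · right
            have := hpres h
            rw [hσ] at this
            exact this.symm
        · rintro x y z (h | h) (h' | h')
          · exact Or.inl (h.trans h')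
          · exact Or.inr ((hpres h).trans h')
          · exact Or.inr (h.trans h')
          · left
            have := hpres h
            rw [hσ] at this
            exact this.trans h' }
  let r : Y → Y := fun x => (Quotient.mk s x).out
  have hr : ∀ x, ρ.SameCycle (r x) x ∨ ρ.SameCycle (σ (r x)) x := fun x =>
    Quotient.mk_out (s := s) x
  have hrs : ∀ x y, (ρ.SameCycle x y ∨ ρ.SameCycle (σ x) y) → r x = r y := by
    intro x y h
    have : Quotient.mk s x = Quotient.mk s y := Quotient.sound h
    simp only [r, this]
  let A : Set Y := {x | ρ.SameCycle (r x) x}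
  have hinv : ∀ x y, ρ.SameCycle x y → (x ∈ A ↔ y ∈ A) := by
    intro x y h
    have e := hrs x y (Or.inl h)
    simp only [A, Set.mem_ofPred_eq, ← e]
    exact ⟨fun k => k.trans h, fun k => k.trans h.symm⟩
  have hA : ∀ x, σ x ∈ A ↔ x ∉ A := by
    intro x
    have e := hrs x (σ x) (Or.inr (Equiv.Perm.SameCycle.refl _ _))
    simp only [A, Set.mem_ofPred_eq, ← e]
    constructor
    · intro h1 h2
      exact hno x (h2.symm.trans h1)
    · intro h
      have := hpres ((hr x).resolve_left h)
      rwa [hσ] at this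
  refine ⟨A, hA, fun x => ?_⟩
  rw [hτρ, hA, ← hinv x (ρ x) ⟨1, by simp⟩]

/-- Every pseudogroup satisfies the Kuratowski property. -/
theorem pseudogroup_kuratowski_property {X : Type*} (S : Set (Set (X × X)))
    (hS : IsPseudogroup S) (E₁ E₂ F₁ F₂ : Set X) (f g h : Set (X × X))
    (hE : Disjoint E₁ E₂) (hfS : f ∈ S) (hfd : pdom f = E₁) (hfr : pran f = E₂)
    (hF : Disjoint F₁ F₂) (hgS : g ∈ S) (hgd : pdom g = F₁) (hgr : pran g = F₂)
    (hhS : h ∈ S) (hhd : pdom h = E₁ ∪ E₂) (hhr : pran h = F₁ ∪ F₂) :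
    ∃ k ∈ S, pdom k = E₁ ∧ pran k = F₂ := by
  classical
  obtain ⟨f1, f2⟩ := hS.partialBij f hfS
  obtain ⟨g1, g2⟩ := hS.partialBij g hgS
  obtain ⟨h1, h2⟩ := hS.partialBij h hhS
  have fd : ∀ x, x ∈ E₁ ↔ ∃ y, (x, y) ∈ f := fun x => by rw [← hfd]; rfl
  have fr : ∀ y, y ∈ E₂ ↔ ∃ x, (x, y) ∈ f := fun x => by rw [← hfr]; rfl
  have gd : ∀ x, x ∈ F₁ ↔ ∃ y, (x, y) ∈ g := fun x => by rw [← hgd]; rfl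
  have gr : ∀ y, y ∈ F₂ ↔ ∃ x, (x, y) ∈ g := fun x => by rw [← hgr]; rfl
  have hd : ∀ x, (x ∈ E₁ ∨ x ∈ E₂) ↔ ∃ y, (x, y) ∈ h := fun x => by
    rw [← Set.mem_union, ← hhd]; rfl
  have hr : ∀ y, (y ∈ F₁ ∨ y ∈ F₂) ↔ ∃ x, (x, y) ∈ h := fun x => by
    rw [← Set.mem_union, ← hhr]; rfl
  have dE : ∀ x, x ∈ E₁ → x ∈ E₂ → False := fun x a b => Set.disjoint_left.1 hE a b
  have dF : ∀ x, x ∈ F₁ → x ∈ F₂ → False := fun x a b => Set.disjoint_left.1 hF a b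
  let Y := {x : X // x ∈ E₁ ∨ x ∈ E₂}
  have exσ : ∀ x : Y, ∃ y : Y, (x.1, y.1) ∈ f ∨ (y.1, x.1) ∈ f := by
    rintro ⟨x, hx | hx⟩
    · obtain ⟨y, hy⟩ := (fd x).1 hx
      exact ⟨⟨y, Or.inr ((fr y).2 ⟨x, hy⟩)⟩, Or.inl hy⟩
    · obtain ⟨y, hy⟩ := (fr x).1 hx
      exact ⟨⟨y, Or.inl ((fd y).2 ⟨x, hy⟩)⟩, Or.inr hy⟩
  have exη : ∀ x : Y, ∃ u, (x.1, u) ∈ h := fun x => (hd x.1).1 x.2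
  choose η hη using exη
  have exτ : ∀ x : Y, ∃ y : Y, (η x, η y) ∈ g ∨ (η y, η x) ∈ g := by
    intro x
    have key : ∀ v, (v ∈ F₁ ∨ v ∈ F₂) → ∃ y : Y, η y = v := by
      intro v hv
      obtain ⟨y, hy⟩ := (hr v).1 hv
      exact ⟨⟨y, (hd y).2 ⟨v, hy⟩⟩, h1 (hη _) hy⟩
    rcases (hr _).2 ⟨_, hη x⟩ with hx | hx
    · obtain ⟨v, hv⟩ := (gd _).1 hx
      obtain ⟨y, rfl⟩ := key v (Or.inr ((gr _).2 ⟨_, hv⟩))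
      exact ⟨y, Or.inl hv⟩
    · obtain ⟨v, hv⟩ := (gr _).1 hx
      obtain ⟨y, rfl⟩ := key v (Or.inl ((gd _).2 ⟨_, hv⟩))
      exact ⟨y, Or.inr hv⟩
  have ηinj : ∀ x y, η x = η y → x = y := fun x y e =>
    Subtype.ext (h2 (hη x) (e ▸ hη y))
  choose σ hσ using exσ
  choose τ hτ using exτ
  have uσ : ∀ x y : Y, ((x.1, y.1) ∈ f ∨ (y.1, x.1) ∈ f) → σ x = y := by
    intro x y hxy
    apply Subtype.ext
    rcases hσ x with hx | hx <;> rcases hxy with hy | hy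
    · exact f1 hx hy
    · exact (dE _ ((fd _).2 ⟨_, hx⟩) ((fr _).2 ⟨_, hy⟩)).elim
    · exact (dE _ ((fd _).2 ⟨_, hy⟩) ((fr _).2 ⟨_, hx⟩)).elim
    · exact f2 hx hy
  have uτ : ∀ x y : Y, ((η x, η y) ∈ g ∨ (η y, η x) ∈ g) → τ x = y := by
    intro x y hxy
    apply ηinj
    rcases hτ x with hx | hx <;> rcases hxy with hy | hy
    · exact g1 hx hy
    · exact (dF _ ((gd _).2 ⟨_, hx⟩) ((gr _).2 ⟨_, hy⟩)).elim
    · exact (dF _ ((gd _).2 ⟨_, hy⟩) ((gr _).2 ⟨_, hx⟩)).elim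
    · exact g2 hx hy
  have iσ : ∀ x, σ (σ x) = x := fun x => uσ _ _ (hσ x).symm
  have iτ : ∀ x, τ (τ x) = x := fun x => uτ _ _ (hτ x).symm
  have nσ : ∀ x, σ x ≠ x := by
    intro x e
    have := hσ x
    rw [e, or_self] at this
    exact dE _ ((fd _).2 ⟨_, this⟩) ((fr _).2 ⟨_, this⟩)
  have nτ : ∀ x, τ x ≠ x := by
    intro x e
    have := hτ x
    rw [e, or_self] at this
    exact dF _ ((gd _).2 ⟨_, this⟩) ((gr _).2 ⟨_, this⟩)
  obtain ⟨A₀, hAσ, hAτ⟩ := exists_common_coloring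
    (⟨σ, σ, iσ, iσ⟩ : Equiv.Perm Y) ⟨τ, τ, iτ, iτ⟩ iσ iτ nσ nτ
  simp only [Equiv.coe_fn_mk] at hAσ hAτ
  let A : Set X := {x | ∃ y ∈ A₀, y.1 = x}
  let B : Set X := {u | ∃ y ∈ A₀, η y = u}
  have mA : ∀ y : Y, y.1 ∈ A ↔ y ∈ A₀ := fun y =>
    ⟨fun ⟨z, hz, e⟩ => Subtype.ext e ▸ hz, fun hy => ⟨y, hy, rfl⟩⟩
  have mB : ∀ y : Y, η y ∈ B ↔ y ∈ A₀ := fun y =>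
    ⟨fun ⟨z, hz, e⟩ => ηinj _ _ e ▸ hz, fun hy => ⟨y, hy, rfl⟩⟩
  have hA : ∀ x y, (x, y) ∈ f → (y ∈ A ↔ x ∉ A) := by
    intro x y hxy
    let x' : Y := ⟨x, Or.inl ((fd x).2 ⟨y, hxy⟩)⟩
    let y' : Y := ⟨y, Or.inr ((fr y).2 ⟨x, hxy⟩)⟩
    have e : σ x' = y' := uσ x' y' (Or.inl hxy)
    have := hAσ x'
    rw [e, ← mA, ← mA] at this
    exact this
  have hB : ∀ u v, (u, v) ∈ g → (v ∈ B ↔ u ∉ B) := by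
    intro u v huv
    obtain ⟨x, hx⟩ := (hr u).1 (Or.inl ((gd u).2 ⟨v, huv⟩))
    obtain ⟨y, hy⟩ := (hr v).1 (Or.inr ((gr v).2 ⟨u, huv⟩))
    let x' : Y := ⟨x, (hd x).2 ⟨u, hx⟩⟩
    let y' : Y := ⟨y, (hd y).2 ⟨v, hy⟩⟩
    have ex : η x' = u := h1 (hη x') hx
    have ey : η y' = v := h1 (hη y') hy
    have e : τ x' = y' := uτ x' y' (Or.inl (by rw [ex, ey]; exact huv))
    have := hAτ x'
    rw [e, ← mB, ← mB, ex, ey] at this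
    exact this
  have hAB : ∀ x u, (x, u) ∈ h → (x ∈ A ↔ u ∈ B) := by
    intro x u hxu
    let x' : Y := ⟨x, (hd x).2 ⟨u, hxu⟩⟩
    have ex : η x' = u := h1 (hη x') hxu
    rw [← ex, mB, ← mA]
  clear_value A B
  let p : Set (X × X) := pid (E₁ ∩ A) ∪ pcomp f (pid (E₁ \ A))
  let q : Set (X × X) := pid (F₂ ∩ B) ∪ pcomp g (pid (F₁ ∩ B))
  have mp : ∀ x y, (x, y) ∈ p ↔ (x ∈ E₁ ∧ x ∈ A ∧ y = x) ∨ (x ∉ A ∧ (x, y) ∈ f) := by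
    intro x y
    simp only [p, pid, pcomp, Set.mem_union, Set.mem_ofPred_eq, Set.mem_inter_iff, Set.mem_diff]
    grind
  have mq : ∀ x y, (x, y) ∈ q ↔ (x ∈ F₂ ∧ x ∈ B ∧ y = x) ∨ (x ∈ B ∧ (x, y) ∈ g) := by
    intro x y
    simp only [q, pid, pcomp, Set.mem_union, Set.mem_ofPred_eq, Set.mem_inter_iff]
    grind
  have pS : p ∈ S := by
    apply hS.union_mem _ (hS.id_mem _) _ (hS.comp_mem _ hfS _ (hS.id_mem _))
    · rw [Set.disjoint_left]
      simp only [pdom, pid, pcomp, Set.mem_ofPred_eq, Set.mem_inter_iff, Set.mem_diff]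
      grind
    · rw [Set.disjoint_left]
      simp only [pran, pid, pcomp, Set.mem_ofPred_eq, Set.mem_inter_iff, Set.mem_diff]
      grind
  have qS : q ∈ S := by
    apply hS.union_mem _ (hS.id_mem _) _ (hS.comp_mem _ hgS _ (hS.id_mem _))
    · rw [Set.disjoint_left]
      simp only [pdom, pid, pcomp, Set.mem_ofPred_eq, Set.mem_inter_iff]
      grind
    · rw [Set.disjoint_left]
      simp only [pran, pid, pcomp, Set.mem_ofPred_eq, Set.mem_inter_iff]
      grind
  clear_value p q
  have p_dom : ∀ x ∈ E₁, ∃ y ∈ A, (x, y) ∈ p := by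
    intro x hx
    by_cases hxA : x ∈ A
    · exact ⟨x, hxA, (mp _ _).2 (Or.inl ⟨hx, hxA, rfl⟩)⟩
    · obtain ⟨y, hy⟩ := (fd x).1 hx
      exact ⟨y, (hA _ _ hy).2 hxA, (mp _ _).2 (Or.inr ⟨hxA, hy⟩)⟩
  have p_dom' : ∀ x y, (x, y) ∈ p → x ∈ E₁ ∧ y ∈ A ∧ (y ∈ E₁ ∨ y ∈ E₂) := by
    intro x y hxy
    rcases (mp _ _).1 hxy with ⟨a, b, rfl⟩ | ⟨a, b⟩
    · exact ⟨a, b, Or.inl a⟩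
    · exact ⟨(fd _).2 ⟨_, b⟩, (hA _ _ b).2 a, Or.inr ((fr _).2 ⟨_, b⟩)⟩
  have p_ran : ∀ y ∈ A, (y ∈ E₁ ∨ y ∈ E₂) → ∃ x, (x, y) ∈ p := by
    rintro y hy (hyE | hyE)
    · exact ⟨y, (mp _ _).2 (Or.inl ⟨hyE, hy, rfl⟩)⟩
    · obtain ⟨x, hx⟩ := (fr y).1 hyE
      exact ⟨x, (mp _ _).2 (Or.inr ⟨(hA _ _ hx).1 hy, hx⟩)⟩
  have q_dom : ∀ u ∈ B, (u ∈ F₁ ∨ u ∈ F₂) → ∃ v, (u, v) ∈ q := by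
    rintro u hu (huF | huF)
    · obtain ⟨v, hv⟩ := (gd u).1 huF
      exact ⟨v, (mq _ _).2 (Or.inr ⟨hu, hv⟩)⟩
    · exact ⟨u, (mq _ _).2 (Or.inl ⟨huF, hu, rfl⟩)⟩
  have q_ran : ∀ u v, (u, v) ∈ q → v ∈ F₂ := by
    intro u v huv
    rcases (mq _ _).1 huv with ⟨a, b, rfl⟩ | ⟨a, b⟩
    · exact a
    · exact (gr _).2 ⟨_, b⟩
  have q_ran' : ∀ v ∈ F₂, ∃ u ∈ B, (u ∈ F₁ ∨ u ∈ F₂) ∧ (u, v) ∈ q := by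
    intro v hv
    by_cases hvB : v ∈ B
    · exact ⟨v, hvB, Or.inr hv, (mq _ _).2 (Or.inl ⟨hv, hvB, rfl⟩)⟩
    · obtain ⟨u, hu⟩ := (gr v).1 hv
      have huB : u ∈ B := by
        by_contra hn
        exact hvB ((hB _ _ hu).2 hn)
      exact ⟨u, huB, Or.inl ((gd _).2 ⟨_, hu⟩), (mq _ _).2 (Or.inr ⟨huB, hu⟩)⟩
  refine ⟨pcomp q (pcomp h p), hS.comp_mem _ qS _ (hS.comp_mem _ hhS _ pS), ?_, ?_⟩
  · ext x
    constructor
    · rintro ⟨v, u, ⟨y, hxy, -⟩, -⟩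
      exact (p_dom' _ _ hxy).1
    · intro hx
      obtain ⟨y, hyA, hxy⟩ := p_dom x hx
      obtain ⟨u, hu⟩ := (hd y).1 (p_dom' _ _ hxy).2.2
      obtain ⟨v, hv⟩ := q_dom u ((hAB _ _ hu).1 hyA) ((hr u).2 ⟨y, hu⟩)
      exact ⟨v, u, ⟨y, hxy, hu⟩, hv⟩
  · ext v
    constructor
    · rintro ⟨x, u, -, huv⟩
      exact q_ran _ _ huv
    · intro hv
      obtain ⟨u, huB, huF, huv⟩ := q_ran' v hv
      obtain ⟨y, hy⟩ := (hr u).1 huF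
      obtain ⟨x, hx⟩ := p_ran y ((hAB _ _ hy).2 huB) ((hd y).2 ⟨u, hy⟩)
      exact ⟨x, u, ⟨y, hx, hy⟩, huv⟩
end

section
/- Let k ≥ 1 and let n(1), …, n(k) ≥ 1 be integers. Consider functions μ assigning to each k-tuple A = (A₁, …, A_k) of subsets A_i ⊆ {1, …, n(i)} a value in [0, ∞), such that: μ of the tuple of full sets ({1,…,n(1)}, …, {1,…,n(k)}) is 1; μ of the componentwise union of A and B equals μ(A) + μ(B) whenever A_i ∩ B_i = ∅ for every i; and μ(A) = μ(B) whenever |A_i| = |B_i| for every i. Then the assignment sending a vector x = (x₁, …, x_k) of non-negative reals satisfying n(1)x₁ + ⋯ + n(k)x_k = 1 to the function μ_x defined by μ_x(A) = Σ_{i=1}^{k} |A_i| x_i is a bijection between the set of such vectors and the set of such functions μ; moreover, μ_x vanishes only on the tuple of empty sets if and only if every x_i is strictly positive. (This classifies the invariant means on the semisimple inverse monoid I_{n(1)} × ⋯ × I_{n(k)}.) -/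
theorem sum_single_aux {k : ℕ} (n : Fin k → ℕ) (x : Fin k → ℝ) (i : Fin k) (a : Fin (n i)) :
    ∑ j, ((Function.update (fun j => (∅ : Set (Fin (n j)))) i {a} j).ncard : ℝ) * x j = x i := by
  rw [Finset.sum_eq_single i]
  · simp
  · intro j _ hj
    simp [Function.update_of_ne hj]
  · simp

theorem mean_formula_aux {k : ℕ} (n : Fin k → ℕ) (hn : ∀ i, 1 ≤ n i)
    (μ : (∀ i, Set (Fin (n i))) → ℝ)
    (hadd : ∀ A B, (∀ i, Disjoint (A i) (B i)) → μ (fun i => A i ∪ B i) = μ A + μ B)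
    (hinv : ∀ A B, (∀ i, (A i).ncard = (B i).ncard) → μ A = μ B)
    (A : ∀ i, Set (Fin (n i))) :
    μ A = ∑ i, ((A i).ncard : ℝ) *
      μ (Function.update (fun j => (∅ : Set (Fin (n j)))) i {⟨0, hn i⟩}) := by
  classical
  have h0 : μ (fun _ => ∅) = 0 := by
    have := hadd (fun _ => ∅) (fun _ => ∅) (by simp)
    simp only [Set.union_self] at this
    linarith
  have h1 : ∀ i (s : Set (Fin (n i))),
      μ (Function.update (fun j => (∅ : Set (Fin (n j)))) i s) = (s.ncard : ℝ) *
        μ (Function.update (fun j => (∅ : Set (Fin (n j)))) i {⟨0, hn i⟩}) := by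
    intro i s
    induction s, s.toFinite using Set.Finite.induction_on with
    | empty => simp [h0]
    | @insert a s ha hs ih =>
      have e : Function.update (fun j => (∅ : Set (Fin (n j)))) i (insert a s) =
          fun j => Function.update (fun j => (∅ : Set (Fin (n j)))) i {a} j ∪
            Function.update (fun j => (∅ : Set (Fin (n j)))) i s j := by
        funext j
        by_cases hj : j = i
        · subst hj; simp
        · simp [Function.update_of_ne hj]
      rw [e, hadd, ih, Set.ncard_insert_of_notMem ha hs,
        hinv (Function.update (fun j => (∅ : Set (Fin (n j)))) i {a})
          (Function.update (fun j => (∅ : Set (Fin (n j)))) i {⟨0, hn i⟩})]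
      · push_cast; ring
      · intro j
        by_cases hj : j = i
        · subst hj; simp
        · simp [Function.update_of_ne hj]
      · intro j
        by_cases hj : j = i
        · subst hj; simpa using ha
        · simp [Function.update_of_ne hj]
  have h2 : ∀ t : Finset (Fin k), μ (fun i => if i ∈ t then A i else ∅) =
      ∑ i ∈ t, μ (Function.update (fun j => (∅ : Set (Fin (n j)))) i (A i)) := by
    intro t
    induction t using Finset.induction_on with
    | empty => simp [h0]
    | insert i t hi ih =>
      rw [Finset.sum_insert hi, ← ih, ← hadd]
      · congr 1
        funext j
        by_cases hj : j = i
        · subst hj; simp [hi]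
        · simp [Function.update_of_ne hj, hj]
      · intro j
        by_cases hj : j = i
        · subst hj; simp [hi]
        · simp [Function.update_of_ne hj]
  have h3 := h2 Finset.univ
  simp only [Finset.mem_univ, if_true] at h3
  rw [h3]
  exact Finset.sum_congr rfl fun i _ => h1 i (A i)

/-- Classification of invariant means on the semisimple inverse monoid
`I_{n(1)} × ⋯ × I_{n(k)}`: the map `x ↦ μ_x`, where `μ_x(A) = Σ_i |A_i| x_i`, is a
bijection from the vectors of non-negative reals with `Σ_i n(i) x_i = 1` onto the set of
invariant means; moreover `μ_x` vanishes only on the tuple of empty sets iff every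
`x_i > 0`. -/
theorem semisimple_invariantMean_classification (k : ℕ) (hk : 1 ≤ k)
    (n : Fin k → ℕ) (hn : ∀ i, 1 ≤ n i) :
    Set.BijOn
      (fun (x : Fin k → ℝ) => fun (A : ∀ i, Set (Fin (n i))) =>
        ∑ i, ((A i).ncard : ℝ) * x i)
      {x : Fin k → ℝ | (∀ i, 0 ≤ x i) ∧ ∑ i, (n i : ℝ) * x i = 1}
      {μ : (∀ i, Set (Fin (n i))) → ℝ |
        (∀ A, 0 ≤ μ A) ∧
        μ (fun _ => Set.univ) = 1 ∧
        (∀ A B, (∀ i, Disjoint (A i) (B i)) →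
          μ (fun i => A i ∪ B i) = μ A + μ B) ∧
        (∀ A B, (∀ i, (A i).ncard = (B i).ncard) → μ A = μ B)} ∧
    ∀ x : Fin k → ℝ, ((∀ i, 0 ≤ x i) ∧ ∑ i, (n i : ℝ) * x i = 1) →
      ((∀ A : ∀ i, Set (Fin (n i)),
          (∑ i, ((A i).ncard : ℝ) * x i) = 0 → ∀ i, A i = ∅) ↔ ∀ i, 0 < x i) := by
  refine ⟨⟨?_, ?_, ?_⟩, ?_⟩
  · rintro x ⟨hx, hs⟩
    refine ⟨fun A => Finset.sum_nonneg fun i _ => mul_nonneg (Nat.cast_nonneg _) (hx i), ?_, ?_, ?_⟩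
    · simpa [Set.ncard_univ] using hs
    · intro A B h
      simp only
      rw [← Finset.sum_add_distrib]
      refine Finset.sum_congr rfl fun i _ => ?_
      rw [Set.ncard_union_eq (h i) (Set.toFinite _) (Set.toFinite _)]
      push_cast; ring
    · intro A B h
      simp only [h]
  · intro x _ y _ h
    funext i
    have := congrFun h (Function.update (fun j => (∅ : Set (Fin (n j)))) i {⟨0, hn i⟩})
    simp only [sum_single_aux] at this
    exact this
  · rintro μ ⟨hpos, h1, hadd, hinv⟩
    have hf := mean_formula_aux n hn μ hadd hinv
    refine ⟨fun i => μ (Function.update (fun j => (∅ : Set (Fin (n j)))) i {⟨0, hn i⟩}),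
      ⟨fun i => hpos _, ?_⟩, ?_⟩
    · rw [hf] at h1
      simpa [Set.ncard_univ] using h1
    · funext A
      exact (hf A).symm
  · rintro x ⟨hx, hs⟩
    constructor
    · intro h i
      refine lt_of_le_of_ne (hx i) fun h0 => ?_
      have := h (Function.update (fun j => (∅ : Set (Fin (n j)))) i {⟨0, hn i⟩})
        (by rw [sum_single_aux]; exact h0.symm) i
      simp at this
    · intro h A hA i
      rw [Finset.sum_eq_zero_iff_of_nonneg
        (fun i _ => mul_nonneg (Nat.cast_nonneg _) (hx i))] at hA
      have := hA i (Finset.mem_univ i)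
      rcases mul_eq_zero.1 this with h' | h'
      · exact (Set.ncard_eq_zero (Set.toFinite _)).1 (by exact_mod_cast h')
      · exact absurd h' (h i).ne'
end

section
/- Let S be a pseudogroup on a set X. Then S is weakly paradoxical if and only if there exists an element a ∈ S with dom a = X such that the complement X ∖ ran a is large for S. -/
open Set

/-- A subset `E` is large for the pseudogroup `S`: there are finitely many
`f₁, …, f_m ∈ S` with all ranges contained in `E` and domains covering `X`. -/
def IsLarge {X : Type*} (S : Set (Set (X × X))) (E : Set X) : Prop :=
  ∃ (m : ℕ) (f : Fin m → Set (X × X)), 1 ≤ m ∧ (∀ i, f i ∈ S) ∧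
    (∀ i, pran (f i) ⊆ E) ∧ (⋃ i, pdom (f i)) = Set.univ

/-- `S` is weakly paradoxical. -/
def WeaklyParadoxical {X : Type*} (S : Set (Set (X × X))) : Prop :=
  ∃ a ∈ S, ∃ b ∈ S, pdom a = Set.univ ∧ pdom b = Set.univ ∧ pran a ∩ pran b = ∅

theorem exists_step {X : Type*} (S : Set (Set (X × X))) (hS : IsPseudogroup S)
    (a : Set (X × X)) (ha : a ∈ S) (had : pdom a = Set.univ) (m : ℕ) (f : Fin m → Set (X × X))
    (hf : ∀ i, f i ∈ S) (hr : ∀ i, pran (f i) ⊆ (pran a)ᶜ) (k : ℕ) (hk : k ≤ m) :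
    ∃ c ∈ S, ∃ b ∈ S, pdom c = Set.univ ∧
      (∀ x, x ∈ pdom b ↔ ∃ i : Fin m, i.1 < k ∧ x ∈ pdom (f i)) ∧
      ∀ x y z, (x, z) ∈ c → (y, z) ∈ b → False := by
  induction k with
  | zero =>
    refine ⟨pid Set.univ, hS.id_mem _, pid ∅, hS.id_mem _, ?_, ?_, ?_⟩
    · ext x; simp [pdom, pid]
    · intro x; simp [pdom, pid]
    · intro x y z _ h; simp [pid] at h
  | succ k ih =>
    obtain ⟨c, hc, b, hb, hcd, hbd, hcb⟩ := ih (by omega)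
    have tot : ∀ r : Set (X × X), pdom r = Set.univ → ∀ x, ∃ y, (x, y) ∈ r := by
      intro r h x
      have : x ∈ pdom r := by rw [h]; trivial
      exact this
    have hct := tot c hcd
    have hat := tot a had
    let g := f ⟨k, by omega⟩
    let d := pcomp c (pcomp g (pid (pdom b)ᶜ))
    have hd : d ∈ S := hS.comp_mem _ hc _ (hS.comp_mem _ (hf _) _ (hS.id_mem _))
    have memd : ∀ x z, (x, z) ∈ d ↔ x ∉ pdom b ∧ ∃ y, (x, y) ∈ g ∧ (y, z) ∈ c := by
      intro x z
      constructor
      · rintro ⟨y, ⟨w, ⟨h1, h2⟩, h3⟩, h4⟩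
        simp only at h2
        subst h2
        exact ⟨h1, y, h3, h4⟩
      · rintro ⟨h1, y, h3, h4⟩
        exact ⟨y, ⟨x, ⟨h1, rfl⟩, h3⟩, h4⟩
    refine ⟨pcomp c a, hS.comp_mem _ hc _ ha, b ∪ d, hS.union_mem _ hb _ hd ?_ ?_, ?_, ?_, ?_⟩
    · rw [Set.disjoint_left]
      rintro x hx ⟨z, hz⟩
      exact ((memd _ _).1 hz).1 hx
    · rw [Set.disjoint_left]
      rintro z ⟨x, hx⟩ ⟨w, hw⟩
      obtain ⟨_, y, _, h⟩ := (memd _ _).1 hw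
      exact hcb _ _ _ h hx
    · refine Set.eq_univ_of_forall fun x => ?_
      obtain ⟨y, hy⟩ := hat x
      obtain ⟨z, hz⟩ := hct y
      exact ⟨z, y, hy, hz⟩
    · intro x
      constructor
      · rintro ⟨z, h | h⟩
        · obtain ⟨i, hi, hx⟩ := (hbd x).1 ⟨z, h⟩
          exact ⟨i, by omega, hx⟩
        · obtain ⟨_, y, h, _⟩ := (memd _ _).1 h
          exact ⟨⟨k, by omega⟩, Nat.lt_succ_self k, y, h⟩
      · rintro ⟨i, hi, hx⟩
        by_cases hxb : x ∈ pdom b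
        · obtain ⟨z, hz⟩ := hxb
          exact ⟨z, Or.inl hz⟩
        · have hik : i = ⟨k, by omega⟩ := by
            apply Fin.ext
            by_contra hne
            exact hxb ((hbd x).2 ⟨i, by simp only at hne; omega, hx⟩)
          rw [hik] at hx
          obtain ⟨y, hy⟩ := hx
          obtain ⟨z, hz⟩ := hct y
          exact ⟨z, Or.inr ((memd _ _).2 ⟨hxb, y, hy, hz⟩)⟩
    · rintro x y z ⟨w, hw, hwz⟩ (h | h)
      · exact hcb _ _ _ hwz h
      · obtain ⟨_, v, hv, hvz⟩ := (memd _ _).1 h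
        have := (hS.partialBij c hc).2 hwz hvz
        subst this
        exact hr _ ⟨y, hv⟩ ⟨x, hw⟩

/-- A pseudogroup is weakly paradoxical iff it has an element `a` with `pdom a = X` whose
range has large complement. -/
theorem weaklyParadoxical_iff_exists_large_complement {X : Type*}
    (S : Set (Set (X × X))) (hS : IsPseudogroup S) :
    WeaklyParadoxical S ↔
      ∃ a ∈ S, pdom a = Set.univ ∧ IsLarge S (pran a)ᶜ := by
  constructor
  · rintro ⟨a, ha, b, hb, had, hbd, hab⟩
    refine ⟨a, ha, had, 1, fun _ => b, le_rfl, fun _ => hb, fun _ y hy hya => ?_, ?_⟩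
    · have : y ∈ pran a ∩ pran b := ⟨hya, hy⟩
      rw [hab] at this
      exact this
    · exact Set.eq_univ_of_forall fun x => Set.mem_iUnion.2 ⟨0, by rw [hbd]; trivial⟩
  · rintro ⟨a, ha, had, m, f, -, hf, hr, hcov⟩
    obtain ⟨c, hc, b, hb, hcd, hbd, hcb⟩ := exists_step S hS a ha had m f hf hr m le_rfl
    refine ⟨c, hc, b, hb, hcd, Set.eq_univ_of_forall fun x => ?_, ?_⟩
    · have hx : x ∈ ⋃ i, pdom (f i) := by rw [hcov]; trivial
      obtain ⟨i, hi⟩ := Set.mem_iUnion.1 hx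
      exact (hbd x).2 ⟨i, i.2, hi⟩
    · refine Set.eq_empty_of_forall_notMem ?_
      rintro z ⟨⟨x, hx⟩, ⟨y, hy⟩⟩
      exact hcb _ _ _ hx hy
end

section
/- Let S be a pseudogroup on a set X. If there exists an element a ∈ S with dom a = X such that the complement X ∖ ran a is large for S, then S admits no invariant mean. -/
open Set

/-- If some `a ∈ S` has full domain and the complement of its range is large, then `S`
admits no invariant mean. -/
theorem no_invariantMean_of_large_complement {X : Type*} (S : Set (Set (X × X)))
    (hS : IsPseudogroup S) (a : Set (X × X)) (ha : a ∈ S)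
    (had : pdom a = Set.univ) (hlarge : IsLarge S (pran a)ᶜ) :
    ¬ ∃ μ : Set X → ℝ, IsInvariantMean S μ := by
  rintro ⟨μ, h0, h1, hadd, hinv⟩
  obtain ⟨m, f, -, hf, hr, hd⟩ := hlarge
  have mono : ∀ A B : Set X, A ⊆ B → μ A ≤ μ B := by
    intro A B hAB
    have h := hadd A (B \ A) Set.disjoint_sdiff_right
    rw [Set.union_diff_cancel hAB] at h
    have := h0 (B \ A)
    linarith
  have hE : μ (pran a)ᶜ = 0 := by
    have h := hadd (pran a) (pran a)ᶜ disjoint_compl_right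
    rw [Set.union_compl_self, h1, ← hinv a ha, had, h1] at h
    linarith
  have hz : ∀ i, μ (pdom (f i)) = 0 := by
    intro i
    have h := mono _ _ (hr i)
    rw [← hinv _ (hf i), hE] at h
    exact le_antisymm h (h0 _)
  have hempty : μ ∅ = 0 := by
    have h := hadd ∅ ∅ (Set.disjoint_empty _)
    rw [Set.union_empty] at h
    linarith
  have hU : ∀ t : Finset (Fin m), μ (⋃ i ∈ t, pdom (f i)) = 0 := by
    classical
    intro t
    induction t using Finset.induction_on with
    | empty => simpa using hempty
    | insert j t _ ih =>
      rw [Finset.set_biUnion_insert, ← Set.union_diff_self,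
        hadd _ _ Set.disjoint_sdiff_right, hz j, zero_add]
      exact le_antisymm (ih ▸ mono _ _ Set.diff_subset) (h0 _)
  have h := hU Finset.univ
  simp only [Finset.mem_univ, Set.iUnion_true, hd, h1] at h
  exact one_ne_zero h
end

section
/- Let S be a pseudogroup on a set X with the property that whenever some f ∈ S has dom f = A and ran f ⊆ B and some g ∈ S has dom g = B and ran g ⊆ A, then some h ∈ S has dom h = A and ran h = B (the property 𝒟 = 𝒥). If S is weakly paradoxical then S is strongly paradoxical. -/
open Set

/-- A pseudogroup satisfying `𝒟 = 𝒥` is weakly paradoxical iff strongly paradoxical. -/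
theorem stronglyParadoxical_of_weaklyParadoxical {X : Type*} (S : Set (Set (X × X)))
    (hS : IsPseudogroup S)
    (hDJ : ∀ (A B : Set X) (f g : Set (X × X)), f ∈ S → pdom f = A → pran f ⊆ B →
      g ∈ S → pdom g = B → pran g ⊆ A → ∃ h ∈ S, pdom h = A ∧ pran h = B)
    (hw : WeaklyParadoxical S) : StronglyParadoxical S := by
  obtain ⟨a, ha, b, hb, hda, hdb, hab⟩ := hw
  have hdid : pdom (pid (pran a)ᶜ) = (pran a)ᶜ := by
    ext x
    constructor
    · rintro ⟨y, hy, -⟩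
      exact hy
    · intro hx
      exact ⟨x, hx, rfl⟩
  have hsub : pran b ⊆ (pran a)ᶜ := by
    intro y hy hya
    have h : y ∈ pran a ∩ pran b := ⟨hya, hy⟩
    rw [hab] at h
    exact h
  obtain ⟨h, hh, hdh, hrh⟩ := hDJ Set.univ (pran a)ᶜ b (pid (pran a)ᶜ) hb hdb hsub
    (hS.id_mem _) hdid (Set.subset_univ _)
  refine ⟨a, ha, h, hh, hda, hdh, ?_, ?_⟩
  · rw [hrh, Set.inter_compl_self]
  · rw [hrh, Set.union_compl_self]
end

section
/- Let S be a pseudogroup on a set X, let a ∈ S satisfy dom a = X, and let E ⊆ X be any subset with E ∩ ran a = ∅. Then there exists b ∈ S with dom b = X and ran b = X ∖ E. -/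
open Set

/-- If `a ∈ S` has full domain and `E` is disjoint from `pran a`, then there is `b ∈ S`
with full domain and range `X ∖ E`. -/
theorem exists_full_domain_range_compl {X : Type*} (S : Set (Set (X × X)))
    (hS : IsPseudogroup S) (a : Set (X × X)) (ha : a ∈ S)
    (had : pdom a = Set.univ) (E : Set X) (hE : E ∩ pran a = ∅) :
    ∃ b ∈ S, pdom b = Set.univ ∧ pran b = Eᶜ := by
  have hb := hS.partialBij a ha
  set F : Set X :=
    {y | ∃ e ∈ E, Relation.ReflTransGen (fun x y => (x, y) ∈ a) e y} with hF
  have hEF : ∀ x ∈ E, x ∈ F := fun x hx => ⟨x, hx, Relation.ReflTransGen.refl⟩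
  have hstep : ∀ x y, x ∈ F → (x, y) ∈ a → y ∈ F := by
    rintro x y ⟨e, he, h⟩ hxy
    exact ⟨e, he, h.tail hxy⟩
  have hcases : ∀ y ∈ F, y ∈ E ∨ ∃ x ∈ F, (x, y) ∈ a := by
    rintro y ⟨e, he, h⟩
    rcases Relation.ReflTransGen.cases_tail h with h | ⟨c, hc, hcy⟩
    · left
      rw [h]
      exact he
    · exact Or.inr ⟨c, ⟨e, he, hc⟩, hcy⟩
  have hdis : ∀ x y, (x, y) ∈ a → y ∉ E := by
    intro x y hxy hy
    have : y ∈ E ∩ pran a := ⟨hy, x, hxy⟩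
    rw [hE] at this
    exact this
  have htot : ∀ x, ∃ y, (x, y) ∈ a := by
    intro x
    have : x ∈ pdom a := by rw [had]; trivial
    exact this
  clear_value F
  refine ⟨pcomp a (pid F) ∪ pid Fᶜ,
    hS.union_mem _ (hS.comp_mem _ ha _ (hS.id_mem _)) _ (hS.id_mem _) ?_ ?_, ?_, ?_⟩
  · rw [Set.disjoint_left]
    rintro x ⟨y, z, ⟨hx, -⟩, -⟩ ⟨w, hw, -⟩
    exact hw hx
  · rw [Set.disjoint_left]
    rintro y ⟨x, z, ⟨hx, hz⟩, hzy⟩ ⟨w, hw, hyw⟩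
    dsimp only at *
    subst hz
    subst hyw
    exact hw (hstep _ _ hx hzy)
  · ext x
    refine ⟨fun _ => trivial, fun _ => ?_⟩
    by_cases hx : x ∈ F
    · obtain ⟨y, hy⟩ := htot x
      exact ⟨y, Or.inl ⟨x, ⟨hx, rfl⟩, hy⟩⟩
    · exact ⟨x, Or.inr ⟨hx, rfl⟩⟩
  · ext y
    constructor
    · rintro ⟨x, ⟨z, -, hzy⟩ | ⟨hx, hxy⟩⟩
      · exact hdis _ _ hzy
      · dsimp only at *
        subst hxy
        exact fun h => hx (hEF _ h)
    · intro hy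
      by_cases hyF : y ∈ F
      · rcases hcases y hyF with h | ⟨x, hx, hxy⟩
        · exact absurd h hy
        · exact ⟨x, Or.inl ⟨x, ⟨hx, rfl⟩, hxy⟩⟩
      · exact ⟨y, Or.inr ⟨hyF, rfl⟩⟩
end

section
/- Every pseudogroup S on a set X satisfies 𝒟 = 𝒥: if some f ∈ S has dom f = A and ran f ⊆ B, and some g ∈ S has dom g = B and ran g ⊆ A, then there exists h ∈ S with dom h = A and ran h = B. -/
open Set

/-- Every pseudogroup satisfies `𝒟 = 𝒥` (a Schröder–Bernstein property). -/
theorem pseudogroup_D_eq_J {X : Type*} (S : Set (Set (X × X))) (hS : IsPseudogroup S)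
    (A B : Set X) (f g : Set (X × X))
    (hfS : f ∈ S) (hfd : pdom f = A) (hfr : pran f ⊆ B)
    (hgS : g ∈ S) (hgd : pdom g = B) (hgr : pran g ⊆ A) :
    ∃ h ∈ S, pdom h = A ∧ pran h = B := by
  obtain ⟨ff, fi⟩ := hS.partialBij f hfS
  obtain ⟨gf, gi⟩ := hS.partialBij g hgS
  -- the Schröder–Bernstein fixed point `C = A \ g (B \ f C)`
  let F : Set X →o Set X :=
    { toFun := fun C => {x | x ∈ A ∧ ∀ y, (y, x) ∈ g → ∃ c ∈ C, (c, y) ∈ f}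
      monotone' := by
        intro C D hCD x hx
        refine ⟨hx.1, fun y hy => ?_⟩
        obtain ⟨c, hc, hcy⟩ := hx.2 y hy
        exact ⟨c, hCD hc, hcy⟩ }
  obtain ⟨C, hC⟩ : ∃ C, F C = C := ⟨F.lfp, F.map_lfp⟩
  have hmem : ∀ x, x ∈ C ↔ x ∈ A ∧ ∀ y, (y, x) ∈ g → ∃ c ∈ C, (c, y) ∈ f := by
    intro x
    conv_lhs => rw [← hC]
    rfl
  have h1 : pcomp f (pid C) ∈ S := hS.comp_mem _ hfS _ (hS.id_mem C)
  have h2 : pcomp (pinv g) (pid (A \ C)) ∈ S :=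
    hS.comp_mem _ (hS.inv_mem _ hgS) _ (hS.id_mem _)
  have e1 : ∀ x y, (x, y) ∈ pcomp f (pid C) ↔ x ∈ C ∧ (x, y) ∈ f := by
    intro x y
    simp [pcomp, pid, and_assoc]
  have e2 : ∀ x y, (x, y) ∈ pcomp (pinv g) (pid (A \ C)) ↔
      (x ∈ A ∧ x ∉ C) ∧ (y, x) ∈ g := by
    intro x y
    simp [pcomp, pid, pinv, and_assoc]
  -- a point outside `C` comes from a point outside `f C`
  have key : ∀ x y, x ∉ C → (y, x) ∈ g → ∀ c ∈ C, (c, y) ∉ f := by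
    intro x y hx hyx c hc hcy
    refine hx ((hmem x).2 ⟨hgr ⟨y, hyx⟩, fun y' hy' => ⟨c, hc, ?_⟩⟩)
    rwa [gi hy' hyx]
  refine ⟨_, hS.union_mem _ h1 _ h2 ?_ ?_, ?_, ?_⟩
  · rw [Set.disjoint_left]
    rintro x ⟨y, hy⟩ ⟨z, hz⟩
    exact ((e2 _ _).1 hz).1.2 ((e1 _ _).1 hy).1
  · rw [Set.disjoint_left]
    rintro y ⟨x, hx⟩ ⟨z, hz⟩
    rw [e1] at hx
    rw [e2] at hz
    exact key z y hz.1.2 hz.2 x hx.1 hx.2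
  · ext x
    constructor
    · rintro ⟨y, hy | hy⟩
      · exact ((hmem x).1 ((e1 _ _).1 hy).1).1
      · exact ((e2 _ _).1 hy).1.1
    · intro hx
      by_cases hxC : x ∈ C
      · rw [← hfd] at hx
        obtain ⟨y, hy⟩ := hx
        exact ⟨y, Or.inl ((e1 _ _).2 ⟨hxC, hy⟩)⟩
      · have : ∃ y, (y, x) ∈ g := by
          by_contra hne
          exact hxC ((hmem x).2 ⟨hx, fun y hy => absurd ⟨y, hy⟩ hne⟩)
        obtain ⟨y, hy⟩ := this
        exact ⟨y, Or.inr ((e2 _ _).2 ⟨⟨hx, hxC⟩, hy⟩)⟩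
  · ext y
    constructor
    · rintro ⟨x, hx | hx⟩
      · exact hfr ⟨x, ((e1 _ _).1 hx).2⟩
      · rw [← hgd]
        exact ⟨x, ((e2 _ _).1 hx).2⟩
    · intro hy
      by_cases hc : ∃ c ∈ C, (c, y) ∈ f
      · obtain ⟨c, hc, hcy⟩ := hc
        exact ⟨c, Or.inl ((e1 _ _).2 ⟨hc, hcy⟩)⟩
      · rw [← hgd] at hy
        obtain ⟨x, hx⟩ := hy
        refine ⟨x, Or.inr ((e2 _ _).2 ⟨⟨hgr ⟨y, hx⟩, fun hxC => ?_⟩, hx⟩)⟩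
        exact hc (((hmem x).1 hxC).2 y hx)
end

section
/- Let (f_{ij}), 1 ≤ i ≤ m, 1 ≤ j ≤ n, be an m × n rook matrix of partial bijections of a set X. For each j put X_j = ⋃_{i=1}^{m} dom f_{ij}, and for each i put Y_i = ⋃_{j=1}^{n} ran f_{ij}. Then the map F from the disjoint union X₁ ⊔ ⋯ ⊔ X_n to the disjoint union Y₁ ⊔ ⋯ ⊔ Y_m, defined by sending the point (x, j) with x ∈ dom f_{ij} to the point (f_{ij}(x), i), is well defined (for each (x, j) there is exactly one i with x ∈ dom f_{ij}) and is a bijection. -/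
open Set

/-- An `m × n` rook matrix of partial bijections of `X`: entries in the same row have
pairwise disjoint ranges and entries in the same column have pairwise disjoint domains. -/
def IsRookMatrix {X : Type*} {m n : ℕ} (f : Fin m → Fin n → Set (X × X)) : Prop :=
  (∀ i j, IsPartialBij (f i j)) ∧
  (∀ (i : Fin m) (j j' : Fin n), j ≠ j' → Disjoint (pran (f i j)) (pran (f i j'))) ∧
  (∀ (j : Fin n) (i i' : Fin m), i ≠ i' → Disjoint (pdom (f i j)) (pdom (f i' j)))

/-- A rook matrix of partial bijections determines a bijection between disjoint unions:
the relation sending `(x, j)` with `x ∈ pdom (f i j)` to `(f i j x, i)` is a partial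
bijection with domain `X₁ ⊔ ⋯ ⊔ X_n` and range `Y₁ ⊔ ⋯ ⊔ Y_m`, where
`X_j = ⋃ i, pdom (f i j)` and `Y_i = ⋃ j, pran (f i j)`. -/
theorem rookMatrix_bijection {X : Type*} {m n : ℕ} (f : Fin m → Fin n → Set (X × X))
    (hf : IsRookMatrix f) :
    IsPartialBij {q : (X × Fin n) × (X × Fin m) | (q.1.1, q.2.1) ∈ f q.2.2 q.1.2} ∧
    pdom {q : (X × Fin n) × (X × Fin m) | (q.1.1, q.2.1) ∈ f q.2.2 q.1.2} =
      {z : X × Fin n | z.1 ∈ ⋃ i, pdom (f i z.2)} ∧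
    pran {q : (X × Fin n) × (X × Fin m) | (q.1.1, q.2.1) ∈ f q.2.2 q.1.2} =
      {z : X × Fin m | z.1 ∈ ⋃ j, pran (f z.2 j)} := by
  obtain ⟨hb, hr, hd⟩ := hf
  refine ⟨⟨?_, ?_⟩, ?_, ?_⟩
  · rintro ⟨x, j⟩ ⟨y, i⟩ ⟨y', i'⟩ h h'
    simp only [Set.mem_setOf_eq] at h h'
    have hi : i = i' := by
      by_contra hne
      exact Set.disjoint_left.mp (hd j i i' hne) ⟨y, h⟩ ⟨y', h'⟩
    subst hi
    rw [(hb i j).1 h h']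
  · rintro ⟨x, j⟩ ⟨x', j'⟩ ⟨y, i⟩ h h'
    simp only [Set.mem_setOf_eq] at h h'
    have hj : j = j' := by
      by_contra hne
      exact Set.disjoint_left.mp (hr i j j' hne) ⟨x, h⟩ ⟨x', h'⟩
    subst hj
    rw [(hb i j).2 h h']
  · ext ⟨x, j⟩
    simp only [pdom, Set.mem_setOf_eq, Set.mem_iUnion]
    exact ⟨fun ⟨⟨y, i⟩, h⟩ => ⟨i, y, h⟩, fun ⟨i, y, h⟩ => ⟨(y, i), h⟩⟩
  · ext ⟨y, i⟩
    simp only [pran, Set.mem_setOf_eq, Set.mem_iUnion]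
    exact ⟨fun ⟨⟨x, j⟩, h⟩ => ⟨j, x, h⟩, fun ⟨j, x, h⟩ => ⟨(x, j), h⟩⟩
end

section
/- Let (a_{ik}) be an m × n rook matrix and (b_{kj}) an n × p rook matrix of partial bijections of a set X. Then for all i and j, the composites a_{i1} ∘ b_{1j}, …, a_{in} ∘ b_{nj} have pairwise disjoint domains and pairwise disjoint ranges, so that their union c_{ij} = ⋃_{k=1}^{n} a_{ik} ∘ b_{kj} is again a partial bijection of X; and the resulting m × p matrix (c_{ij}) is again a rook matrix of partial bijections of X. -/
open Set

theorem IsRookMatrix.row_inj {X : Type*} {m n : ℕ} {f : Fin m → Fin n → Set (X × X)}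
    (h : IsRookMatrix f) {i : Fin m} {k l : Fin n} {x x' y : X}
    (h1 : (x, y) ∈ f i k) (h2 : (x', y) ∈ f i l) : k = l ∧ x = x' := by
  have hk : k = l := by
    by_contra hne
    exact Set.disjoint_left.1 (h.2.1 i k l hne) ⟨x, h1⟩ ⟨x', h2⟩
  subst hk
  exact ⟨rfl, (h.1 i k).2 h1 h2⟩

theorem IsRookMatrix.col_inj {X : Type*} {m n : ℕ} {f : Fin m → Fin n → Set (X × X)}
    (h : IsRookMatrix f) {i l : Fin m} {k : Fin n} {x y y' : X}
    (h1 : (x, y) ∈ f i k) (h2 : (x, y') ∈ f l k) : i = l ∧ y = y' := by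
  have hk : i = l := by
    by_contra hne
    exact Set.disjoint_left.1 (h.2.2 k i l hne) ⟨y, h1⟩ ⟨y', h2⟩
  subst hk
  exact ⟨rfl, (h.1 i k).1 h1 h2⟩

/-- The product of rook matrices: for an `m × n` rook matrix `a` and an `n × p` rook
matrix `b`, the composites `a i k ∘ b k j` (for fixed `i`, `j`) have pairwise disjoint
domains and ranges, and the matrix of unions `c i j = ⋃ k, a i k ∘ b k j` is again a rook
matrix of partial bijections. -/
theorem rookMatrix_mul {X : Type*} {m n p : ℕ}
    (a : Fin m → Fin n → Set (X × X)) (b : Fin n → Fin p → Set (X × X))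
    (ha : IsRookMatrix a) (hb : IsRookMatrix b) :
    (∀ (i : Fin m) (j : Fin p) (k k' : Fin n), k ≠ k' →
      Disjoint (pdom (pcomp (a i k) (b k j))) (pdom (pcomp (a i k') (b k' j))) ∧
      Disjoint (pran (pcomp (a i k) (b k j))) (pran (pcomp (a i k') (b k' j)))) ∧
    IsRookMatrix (fun (i : Fin m) (j : Fin p) => ⋃ k, pcomp (a i k) (b k j)) := by
  refine ⟨fun i j k k' hk => ⟨?_, ?_⟩, fun i j => ⟨?_, ?_⟩, fun i j j' hj => ?_,
    fun j i i' hi => ?_⟩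
  · rw [Set.disjoint_left]
    rintro x ⟨y, z, h1, h2⟩ ⟨y', z', h3, h4⟩
    exact hk (hb.col_inj h1 h3).1
  · rw [Set.disjoint_left]
    rintro y ⟨x, z, h1, h2⟩ ⟨x', z', h3, h4⟩
    exact hk (ha.row_inj h2 h4).1
  · intro x y y' h h'
    obtain ⟨k, z, h1, h2⟩ := Set.mem_iUnion.1 h
    obtain ⟨k', z', h3, h4⟩ := Set.mem_iUnion.1 h'
    obtain ⟨rfl, rfl⟩ := hb.col_inj h1 h3
    exact (ha.col_inj h2 h4).2
  · intro x x' y h h'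
    obtain ⟨k, z, h1, h2⟩ := Set.mem_iUnion.1 h
    obtain ⟨k', z', h3, h4⟩ := Set.mem_iUnion.1 h'
    obtain ⟨rfl, rfl⟩ := ha.row_inj h2 h4
    exact (hb.row_inj h1 h3).2
  · rw [Set.disjoint_left]
    rintro y ⟨x, h⟩ ⟨x', h'⟩
    obtain ⟨k, z, h1, h2⟩ := Set.mem_iUnion.1 h
    obtain ⟨k', z', h3, h4⟩ := Set.mem_iUnion.1 h'
    obtain ⟨rfl, rfl⟩ := ha.row_inj h2 h4
    exact hj (hb.row_inj h1 h3).1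
  · rw [Set.disjoint_left]
    rintro x ⟨y, h⟩ ⟨y', h'⟩
    obtain ⟨k, z, h1, h2⟩ := Set.mem_iUnion.1 h
    obtain ⟨k', z', h3, h4⟩ := Set.mem_iUnion.1 h'
    obtain ⟨rfl, rfl⟩ := hb.col_inj h1 h3
    exact hi (ha.col_inj h2 h4).1
end
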